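/- If A is a tame central essential arrangement, then the coordinate ring S/I of the closure of the universal critical variety is Cohen–Macaulay: its projective dimension over S equals its codimension ℓ. -/

import Mathlib

open MvPolynomial Finset

/-- The `i`-th defining linear form, in `S = ℂ[a_1,…,a_n,x_1,…,x_ℓ]`
(variables `Sum.inl i = a_i`, `Sum.inr j = x_j`). -/
noncomputable def fS {ℓ n : ℕ} (c : Fin n → Fin ℓ → ℂ) (i : Fin n) :
    MvPolynomial (Fin n ⊕ Fin ℓ) ℂ :=
  ∑ j, C (c i j) * X (Sum.inr j)

/-- The defining polynomial `Q = f_1 ⋯ f_n` of the arrangement, in `S`. -/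
noncomputable def QS {ℓ n : ℕ} (c : Fin n → Fin ℓ → ℂ) : MvPolynomial (Fin n ⊕ Fin ℓ) ℂ :=
  ∏ i, fS c i

/-- `Q/f_i`. -/
noncomputable def Qdiv {ℓ n : ℕ} (c : Fin n → Fin ℓ → ℂ) (i : Fin n) :
    MvPolynomial (Fin n ⊕ Fin ℓ) ℂ :=
  ∏ k ∈ univ.erase i, fS c k

/-- `Q·d_j = ∑_i a_i c_{ij} Q/f_i`, the numerator of the `j`-th coordinate of the
universal 1-form `ω_a = ∑_i a_i df_i/f_i`. -/
noncomputable def Qd {ℓ n : ℕ} (c : Fin n → Fin ℓ → ℂ) (j : Fin ℓ) :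
    MvPolynomial (Fin n ⊕ Fin ℓ) ℂ :=
  ∑ i, X (Sum.inl i) * C (c i j) * Qdiv c i

/-- `θ = ∑_j θ_j ∂/∂x_j` (coefficients in `S`) is a logarithmic derivation: `θ(Q) ∈ (Q)`. -/
def IsLogDer {ℓ n : ℕ} (c : Fin n → Fin ℓ → ℂ)
    (θ : Fin ℓ → MvPolynomial (Fin n ⊕ Fin ℓ) ℂ) : Prop :=
  (∑ j, θ j * pderiv (Sum.inr j) (QS c)) ∈ Ideal.span {QS c}

/-- `g = ⟨θ, ω_a⟩`, i.e. `Q·g = ∑_i a_i (Q/f_i) θ(f_i)`. -/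
def PairsWith {ℓ n : ℕ} (c : Fin n → Fin ℓ → ℂ)
    (θ : Fin ℓ → MvPolynomial (Fin n ⊕ Fin ℓ) ℂ)
    (g : MvPolynomial (Fin n ⊕ Fin ℓ) ℂ) : Prop :=
  QS c * g = ∑ i, X (Sum.inl i) * Qdiv c i * (∑ j, θ j * pderiv (Sum.inr j) (fS c i))

/-- The logarithmic ideal `I(A) = (⟨θ, ω_a⟩ : θ ∈ Der(A))  ⊆ S`. -/
noncomputable def Ilog {ℓ n : ℕ} (c : Fin n → Fin ℓ → ℂ) :
    Ideal (MvPolynomial (Fin n ⊕ Fin ℓ) ℂ) :=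
  Ideal.span {g | ∃ θ, IsLogDer c θ ∧ PairsWith c θ g}

/-- The grading of `S` by degree in the `x`-variables. -/
noncomputable def xwt {ℓ n : ℕ} : (Fin n ⊕ Fin ℓ) → ℕ :=
  Sum.elim (fun _ => 0) (fun _ => 1)

/-- Wedge (interior coefficient formula) of a 1-form with coordinates `v` against a form
given by its coefficient function `μ` on index sets: `(v ∧ μ)_T = ∑_{j∈T} ± v_j μ_{T∖j}`. -/
noncomputable def wedge1 {ℓ : ℕ} {A : Type*} [CommRing A] (v : Fin ℓ → A)
    (μ : Finset (Fin ℓ) → A) (T : Finset (Fin ℓ)) : A :=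
  ∑ j ∈ T, (-1 : A) ^ ((T.filter (· < j)).card) * v j * μ (T.erase j)

lemma wedge1_add {ℓ : ℕ} {A : Type*} [CommRing A] (v : Fin ℓ → A) (a b : Finset (Fin ℓ) → A)
    (T : Finset (Fin ℓ)) : wedge1 v (a + b) T = wedge1 v a T + wedge1 v b T := by
  simp [wedge1, mul_add, Finset.sum_add_distrib]

lemma wedge1_smul {ℓ : ℕ} {A : Type*} [CommRing A] (v : Fin ℓ → A) (r : A)
    (a : Finset (Fin ℓ) → A) (T : Finset (Fin ℓ)) : wedge1 v (r • a) T = r * wedge1 v a T := by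
  simp only [wedge1, Pi.smul_apply, smul_eq_mul, Finset.mul_sum]
  exact Finset.sum_congr rfl (fun j _ => by ring)

/-- Wedge product of a `p`-form `μ` with a form `ν` (coefficient functions on index sets):
`(μ ∧ ν)_T = ∑_{B ⊆ T, |B| = p} ± μ_B ν_{T∖B}`, with the shuffle sign. -/
noncomputable def wedgeP {ℓ : ℕ} {A : Type*} [CommRing A] (p : ℕ)
    (μ ν : Finset (Fin ℓ) → A) (T : Finset (Fin ℓ)) : A :=
  ∑ B ∈ T.powersetCard p,
    (-1 : A) ^ (∑ b ∈ B, ((T \ B).filter (· < b)).card) * μ B * ν (T \ B)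

/-- The module of (numerators of) logarithmic `p`-forms of the arrangement with defining
polynomial `Q`: a form `η ∈ Ω^p(A)` is written `η = μ/Q` with `μ` a polynomial `p`-form,
and the condition `Q·dη` regular is equivalent to `Q ∣ (dQ ∧ μ)` coefficientwise.
(The grading: `η` has total degree `m` iff each `μ_T` is homogeneous of degree `m+n-p`.) -/
noncomputable def logForms (ℓ : ℕ) (Q : MvPolynomial (Fin ℓ) ℂ) (p : ℕ) :
    Submodule (MvPolynomial (Fin ℓ) ℂ) (Finset (Fin ℓ) → MvPolynomial (Fin ℓ) ℂ) where
  carrier := {μ | (∀ T, T.card ≠ p → μ T = 0) ∧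
    ∀ T, Q ∣ wedge1 (fun j => pderiv j Q) μ T}
  add_mem' := by
    rintro a b ⟨ha1, ha2⟩ ⟨hb1, hb2⟩
    refine ⟨fun T hT => by simp [Pi.add_apply, ha1 T hT, hb1 T hT], fun T => ?_⟩
    rw [wedge1_add]
    exact dvd_add (ha2 T) (hb2 T)
  zero_mem' := ⟨fun _ _ => rfl, fun T => by simp [wedge1]⟩
  smul_mem' := by
    rintro r a ⟨ha1, ha2⟩
    refine ⟨fun T hT => by simp [ha1 T hT], fun T => ?_⟩
    rw [wedge1_smul]
    exact Dvd.dvd.mul_left (ha2 T) r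

/-- The defining polynomial in `R = ℂ[x_1,…,x_ℓ]`. -/
noncomputable def Qx {ℓ n : ℕ} (c : Fin n → Fin ℓ → ℂ) : MvPolynomial (Fin ℓ) ℂ :=
  ∏ i, ∑ j, C (c i j) * X j

/-- Projective dimension at most `m` over `R`. -/
def pdLE (R : Type) [CommRing R] : ℕ → (M : Type) → [AddCommGroup M] → [Module R M] → Prop
  | 0, M, _, _ => Module.Projective R M
  | m + 1, M, _, _ => ∃ (k : ℕ) (φ : (Fin k → R) →ₗ[R] M),
      Function.Surjective φ ∧ pdLE R m (LinearMap.ker φ)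

/-- Tameness: `pd_R Ω^p(A) ≤ p` for all `0 ≤ p ≤ ℓ`. -/
def ArrTame {ℓ n : ℕ} (c : Fin n → Fin ℓ → ℂ) : Prop :=
  ∀ p ≤ ℓ, pdLE (MvPolynomial (Fin ℓ) ℂ) p (logForms ℓ (Qx c) p)

open CategoryTheory CategoryTheory.Abelian in
/-- Ext group of unbundled modules. -/
abbrev EX (S : Type) [CommRing S] (N M : Type) [AddCommGroup N] [Module S N]
    [AddCommGroup M] [Module S M] (j : ℕ) : Type :=
  Ext.{0} (ModuleCat.of S N) (ModuleCat.of S M) j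

section ExtPart
open CategoryTheory CategoryTheory.Abelian

variable {S : Type} [CommRing S]
  {N A B C' M : Type} [AddCommGroup N] [Module S N] [AddCommGroup A] [Module S A]
  [AddCommGroup B] [Module S B] [AddCommGroup C'] [Module S C'] [AddCommGroup M] [Module S M]

/-- The short complex of an exact pair. -/
abbrev scx (f : A →ₗ[S] B) (g : B →ₗ[S] C') (h : Function.Exact f g) :
    ShortComplex (ModuleCat.{0} S) :=
  ShortComplex.mk (ModuleCat.ofHom f) (ModuleCat.ofHom g) (by
    ext x; exact h.apply_apply_eq_zero x)

lemma scx_se (f : A →ₗ[S] B) (g : B →ₗ[S] C') (h : Function.Exact f g)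
    (hf : Function.Injective f) (hg : Function.Surjective g) : (scx f g h).ShortExact :=
  ModuleCat.shortComplex_shortExact (scx f g h) h hf hg

lemma EX_smul_zero (y : S) (hy : ∀ x : N, y • x = 0) (j : ℕ) (e : EX S N M j) : y • e = 0 := by
  have : y • (𝟙 (ModuleCat.of S N)) = 0 := by
    ext x; exact hy x
  have h2 : y • e = (Ext.mk₀ (y • (𝟙 (ModuleCat.of S N)))).comp e (zero_add j) := by
    rw [Ext.mk₀_smul, Ext.smul_comp, Ext.mk₀_id_comp]
  rw [h2, this, Ext.mk₀_zero, Ext.zero_comp]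

/-- push forward -/
noncomputable def pushE {j : ℕ} (f : A →ₗ[S] B) (e : EX S N A j) : EX S N B j :=
  e.comp (Ext.mk₀ (ModuleCat.ofHom f)) (add_zero j)

/-- pull back -/
noncomputable def pullE {j : ℕ} (f : A →ₗ[S] B) (e : EX S B N j) : EX S A N j :=
  (Ext.mk₀ (ModuleCat.ofHom f)).comp e (zero_add j)

lemma pushE_smul {j : ℕ} (f : A →ₗ[S] B) (e : EX S N A j) (r : S) :
    pushE f (r • e) = r • pushE f e := by
  simp [pushE]

lemma pushE_add {j : ℕ} (f : A →ₗ[S] B) (e e' : EX S N A j) :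
    pushE f (e + e') = pushE f e + pushE f e' := by
  simp [pushE]

lemma pushE_zero {j : ℕ} (f : A →ₗ[S] B) : pushE f (0 : EX S N A j) = 0 := by
  simp [pushE]

lemma pullE_smul {j : ℕ} (f : A →ₗ[S] B) (e : EX S B N j) (r : S) :
    pullE f (r • e) = r • pullE f e := by
  simp [pullE]

lemma pullE_zero {j : ℕ} (f : A →ₗ[S] B) : pullE f (0 : EX S B N j) = 0 := by
  simp [pullE]

lemma pushE_push {j : ℕ} (f : A →ₗ[S] B) (g : B →ₗ[S] C') (e : EX S N A j) :
    pushE g (pushE f e) = pushE (g ∘ₗ f) e := by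
  simp [pushE]

lemma pullE_pull {j : ℕ} (f : A →ₗ[S] B) (g : B →ₗ[S] C') (e : EX S C' N j) :
    pullE f (pullE g e) = pullE (g ∘ₗ f) e := by
  simp [pullE]

lemma pushE_lsmul {j : ℕ} (e : EX S N A j) (r : S) :
    pushE (r • (LinearMap.id : A →ₗ[S] A)) e = r • e := by
  rw [Ext.smul_eq_comp_mk₀]; rfl

lemma pullE_lsmul {j : ℕ} (e : EX S A N j) (r : S) :
    pullE (r • (LinearMap.id : A →ₗ[S] A)) e = r • e := by
  have : r • e = (Ext.mk₀ (r • (𝟙 (ModuleCat.of S A)))).comp e (zero_add j) := by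
    rw [Ext.mk₀_smul, Ext.smul_comp, Ext.mk₀_id_comp]
  rw [this]; rfl

variable (f : A →ₗ[S] B) (g : B →ₗ[S] C') (h : Function.Exact f g)
    (hf : Function.Injective f) (hg : Function.Surjective g)
include h hf hg

lemma cov_two {j : ℕ} (e : EX S N B j) (he : pushE g e = 0) : ∃ e' : EX S N A j, pushE f e' = e :=
  Ext.covariant_sequence_exact₂ (ModuleCat.of S N) (scx_se f g h hf hg) e he

lemma contra_two {j : ℕ} (e : EX S B N j) (he : pullE f e = 0) :
    ∃ e' : EX S C' N j, pullE g e' = e :=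
  Ext.contravariant_sequence_exact₂ (scx_se f g h hf hg) (ModuleCat.of S N) e he

lemma cov_C {j : ℕ} (hB : Subsingleton (EX S N B j)) (hA : Subsingleton (EX S N A (j+1))) :
    Subsingleton (EX S N C' j) := by
  refine subsingleton_of_forall_eq 0 fun e => ?_
  obtain ⟨b, hb⟩ := Ext.covariant_sequence_exact₃ (ModuleCat.of S N) (scx_se f g h hf hg) e rfl
    (hA.elim _ _)
  rw [← hb, show b = 0 from hB.elim _ _, Ext.zero_comp]

lemma contra_B {j : ℕ} (hA : Subsingleton (EX S A N j)) (hC : Subsingleton (EX S C' N j)) :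
    Subsingleton (EX S B N j) := by
  refine subsingleton_of_forall_eq 0 fun e => ?_
  obtain ⟨b, rfl⟩ := contra_two f g h hf hg e (hA.elim _ _)
  rw [show b = 0 from hC.elim _ _, pullE_zero]

/-- torsion statement: element of Ext(N,A) dying in Ext(N,B), when Ext^{j-1}(N,C) is torsion. -/
lemma cov_tors {j : ℕ} (t : S) (ht : ∀ k, k + 1 = j → ∀ e : EX S N C' k, ∃ a, t ^ a • e = 0)
    (e : EX S N A j) (he : pushE f e = 0) : ∃ a, t ^ a • e = 0 := by
  rcases j with _ | j
  · have : Mono (ModuleCat.ofHom f) := (ModuleCat.mono_iff_injective _).2 hf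
    refine ⟨0, ?_⟩
    have := Ext.postcomp_mk₀_injective_of_mono (ModuleCat.of S N) (ModuleCat.ofHom f)
    rw [pow_zero, one_smul]
    apply this
    rw [map_zero]
    exact he
  · obtain ⟨b, hb⟩ := Ext.covariant_sequence_exact₁ (ModuleCat.of S N) (scx_se f g h hf hg) e
      he rfl
    obtain ⟨a, ha⟩ := ht j rfl b
    refine ⟨a, ?_⟩
    rw [← hb, ← Ext.smul_comp]
    rw [ha]
    rw [Ext.zero_comp]

/-- pull back along epi is injective if lower Ext of kernel vanishes. -/
lemma contra_inj {j : ℕ} (hA : ∀ k, k + 1 = j → Subsingleton (EX S A N k))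
    (e : EX S C' N j) (he : pullE g e = 0) : e = 0 := by
  rcases j with _ | j
  · have : Epi (ModuleCat.ofHom g) := (ModuleCat.epi_iff_surjective _).2 hg
    have := Ext.precomp_mk₀_injective_of_epi (ModuleCat.of S N) (ModuleCat.ofHom g)
    apply this
    rw [map_zero]
    exact he
  · obtain ⟨b, hb⟩ := Ext.contravariant_sequence_exact₃ (scx_se f g h hf hg) (ModuleCat.of S N) e
      he (n₀ := j) (by omega)
    have := hA j rfl
    rw [← hb, show b = 0 from this.elim _ _, Ext.comp_zero]

/-- If `B` is projective, `Ext^{j+1}(C,N)` is a quotient of `Ext^j(A,N)`. -/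
lemma contra_shift [Module.Projective S B] {j : ℕ} (t : S)
    (hA : ∀ e : EX S A N j, ∃ a, t ^ a • e = 0)
    (e : EX S C' N (j+1)) : ∃ a, t ^ a • e = 0 := by
  have hp : Projective (ModuleCat.of S B) := (IsProjective.iff_projective _).1 inferInstance
  obtain ⟨b, hb⟩ := Ext.contravariant_sequence_exact₃ (scx_se f g h hf hg) (ModuleCat.of S N) e
      (Ext.eq_zero_of_projective (P := ModuleCat.of S B) _) (n₀ := j) (by omega)
  obtain ⟨a, ha⟩ := hA b
  refine ⟨a, ?_⟩
  rw [← hb, ← Ext.comp_smul]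
  rw [ha]
  rw [Ext.comp_zero]

end ExtPart

section TorsPart
open CategoryTheory CategoryTheory.Abelian

lemma EX_tors {S : Type} [CommRing S] [IsNoetherianRing S] (t : S)
    {K : Type} [AddCommGroup K] [Module S K] (hK : ∀ x : K, ∃ a : ℕ, t ^ a • x = 0) (j : ℕ) :
    ∀ (N : Type) [AddCommGroup N] [Module S N] [Module.Finite S N] (e : EX S N K j),
      ∃ a : ℕ, t ^ a • e = 0 := by
  induction j with
  | zero =>
    intro N _ _ _ e
    classical
    obtain ⟨φ, rfl⟩ := Ext.addEquiv₀.symm.surjective e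
    obtain ⟨s, hs⟩ := (Module.Finite.fg_top : (⊤ : Submodule S N).FG)
    choose a ha using hK
    refine ⟨∑ x ∈ s, a (φ.hom x), ?_⟩
    have : t ^ (∑ x ∈ s, a (φ.hom x)) • φ = 0 := by
      apply ModuleCat.hom_ext
      refine LinearMap.ext_on hs ?_
      intro x hx
      change t ^ (∑ x ∈ s, a (φ.hom x)) • φ.hom x = 0
      rw [← Finset.add_sum_erase _ _ hx, add_comm, pow_add, mul_smul]
      simp [ha]
    change t ^ _ • Ext.mk₀ φ = 0
    rw [← Ext.mk₀_smul, this, Ext.mk₀_zero]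
  | succ j ih =>
    intro N _ _ _ e
    obtain ⟨k, p, hp⟩ := Module.Finite.exists_fin' S N
    have hex : Function.Exact (LinearMap.ker p).subtype p := fun x => by simp
    exact contra_shift (LinearMap.ker p).subtype p hex (LinearMap.ker p).injective_subtype hp t
      (ih _) e

/-- Regular sequence up to `g`-power torsion. -/
def QR {S : Type} [CommRing S] (g : S) : Ideal S → List S → Prop
  | _, [] => True
  | 𝔞, y :: ys => (∀ m, y * m ∈ 𝔞 → ∃ a : ℕ, g ^ a * m ∈ 𝔞) ∧ QR g (𝔞 ⊔ Ideal.span {y}) ys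

lemma QR_tors {S : Type} [CommRing S] [IsNoetherianRing S] (g : S)
    (N : Type) [AddCommGroup N] [Module S N] [Module.Finite S N] (ys : List S) :
    ∀ (𝔞 : Ideal S), QR g 𝔞 ys → (∀ y ∈ ys, ∀ x : N, y • x = 0) →
    ∀ j < ys.length, ∀ e : EX S N (S ⧸ 𝔞) j, ∃ a : ℕ, g ^ a • e = 0 := by
  induction ys with
  | nil => intro _ _ _ j hj; simp at hj
  | cons y ys ih =>
    intro 𝔞 hQ hN j hj e
    obtain ⟨h1, h2⟩ := hQ
    have IH := ih _ h2 (fun z hz => hN z (List.mem_cons_of_mem _ hz))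
    let φ : (S ⧸ 𝔞) →ₗ[S] (S ⧸ 𝔞) := y • LinearMap.id
    let ψ : (S ⧸ 𝔞) →ₗ[S] (S ⧸ (𝔞 ⊔ Ideal.span {y})) :=
      Submodule.factor (le_sup_left : 𝔞 ≤ 𝔞 ⊔ Ideal.span {y})
    have hψ : Function.Surjective ψ := Submodule.factor_surjective _
    have hex : Function.Exact (LinearMap.range φ).subtype ψ := by
      intro x
      obtain ⟨x, rfl⟩ := Submodule.Quotient.mk_surjective _ x
      have e1 : ψ (Submodule.Quotient.mk x) = Submodule.Quotient.mk x := rfl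
      rw [e1, Submodule.Quotient.mk_eq_zero]
      simp only [Submodule.coe_subtype, Subtype.range_coe_subtype, Set.mem_ofPred_eq,
        LinearMap.mem_range]
      constructor
      · intro hx
        obtain ⟨u, hu, v, hv, rfl⟩ := Submodule.mem_sup.1 hx
        obtain ⟨w, rfl⟩ := Ideal.mem_span_singleton'.1 hv
        refine ⟨Submodule.Quotient.mk w, ?_⟩
        change y • (Submodule.Quotient.mk w : S ⧸ 𝔞) = _
        rw [← Submodule.Quotient.mk_smul, Submodule.Quotient.eq]
        have : y • w - (u + w * y) = -u := by simp only [smul_eq_mul]; ring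
        rw [this]; exact neg_mem hu
      · rintro ⟨w, hw⟩
        obtain ⟨w, rfl⟩ := Submodule.Quotient.mk_surjective _ w
        change y • (Submodule.Quotient.mk w : S ⧸ 𝔞) = _ at hw
        rw [← Submodule.Quotient.mk_smul, Submodule.Quotient.eq] at hw
        have : x = - (y • w - x) + w * y := by simp only [smul_eq_mul]; ring
        rw [this]
        exact Submodule.add_mem_sup (neg_mem hw) (Ideal.mul_mem_left _ _ (Ideal.mem_span_singleton_self y))
    have hex2 : Function.Exact (LinearMap.ker φ).subtype φ.rangeRestrict := fun x => by
      simp [← Subtype.coe_inj]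
    have hK : ∀ x : LinearMap.ker φ, ∃ a : ℕ, g ^ a • x = 0 := by
      rintro ⟨x, hx⟩
      obtain ⟨x, rfl⟩ := Submodule.Quotient.mk_surjective _ x
      change y • (Submodule.Quotient.mk x : S ⧸ 𝔞) = _ at hx
      rw [← Submodule.Quotient.mk_smul, Submodule.Quotient.mk_eq_zero] at hx
      obtain ⟨a, ha⟩ := h1 x hx
      refine ⟨a, Subtype.ext ?_⟩
      change g ^ a • (Submodule.Quotient.mk x : S ⧸ 𝔞) = 0
      rw [← Submodule.Quotient.mk_smul, Submodule.Quotient.mk_eq_zero]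
      exact ha
    have hz : pushE (LinearMap.range φ).subtype (pushE φ.rangeRestrict e) = 0 := by
      rw [pushE_push]
      have : (LinearMap.range φ).subtype ∘ₗ φ.rangeRestrict = y • LinearMap.id := by
        ext; rfl
      rw [this, pushE_lsmul]
      exact EX_smul_zero y (hN y (by simp)) j e
    obtain ⟨a, ha⟩ := cov_tors (LinearMap.range φ).subtype ψ hex
      (LinearMap.range φ).injective_subtype hψ g
      (fun k hk e => IH k (by simp at hj; omega) e) _ hz
    rw [← pushE_smul] at ha
    obtain ⟨e', he'⟩ := cov_two (LinearMap.ker φ).subtype φ.rangeRestrict hex2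
      (LinearMap.ker φ).injective_subtype φ.surjective_rangeRestrict _ ha
    obtain ⟨b, hb⟩ := EX_tors g hK j N e'
    refine ⟨b + a, ?_⟩
    rw [pow_add, mul_smul, ← he', ← pushE_smul, hb, pushE_zero]

lemma descent {S : Type} [CommRing S] [IsNoetherianRing S] {n ℓ : ℕ} (I : Ideal S)
    (f : Fin n → S)
    (H : ∀ (F : Finset (Fin n)) (N : Type) [AddCommGroup N] [Module S N] [Module.Finite S N],
      (∀ y ∈ I, ∀ x : N, y • x = 0) → (∀ i ∈ F, ∀ x : N, f i • x = 0) →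
      ∀ j < ℓ, ∀ e : EX S N S j, ∃ a : ℕ, (∏ i ∈ Fᶜ, f i) ^ a • e = 0) :
    ∀ (k : ℕ) (F : Finset (Fin n)), Fᶜ.card = k →
      ∀ (N : Type) [AddCommGroup N] [Module S N] [Module.Finite S N],
      (∀ y ∈ I, ∀ x : N, y • x = 0) → (∀ i ∈ F, ∀ x : N, f i • x = 0) →
      ∀ j < ℓ, Subsingleton (EX S N S j) := by
  intro k
  induction k with
  | zero =>
    intro F hF N _ _ _ hI hFN j hj
    refine subsingleton_of_forall_eq 0 fun e => ?_
    obtain ⟨a, ha⟩ := H F N hI hFN j hj e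
    rw [Finset.card_eq_zero] at hF
    simpa [hF] using ha
  | succ k ih =>
    intro F hF
    let Good : S → Prop := fun t => ∀ (N : Type) [AddCommGroup N] [Module S N] [Module.Finite S N],
      (∀ y ∈ I, ∀ x : N, y • x = 0) → (∀ i ∈ F, ∀ x : N, f i • x = 0) → (∀ x : N, t • x = 0) →
      ∀ j < ℓ, Subsingleton (EX S N S j)
    have gone : Good 1 := by
      intro N _ _ _ _ _ h1 j hj
      refine subsingleton_of_forall_eq 0 fun e => ?_
      rw [← one_smul S e]; exact EX_smul_zero 1 h1 j e
    have gmul : ∀ a b, Good a → Good b → Good (a * b) := by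
      intro a b ha hb N _ _ _ h1 h2 h3 j hj
      let φ : N →ₗ[S] N := a • LinearMap.id
      have hex : Function.Exact (LinearMap.range φ).subtype (LinearMap.range φ).mkQ := fun x => by
        simp
      refine contra_B _ _ hex (LinearMap.range φ).injective_subtype (Submodule.mkQ_surjective _)
        (hb _ ?_ ?_ ?_ j hj) (ha _ ?_ ?_ ?_ j hj)
      · rintro y hy ⟨x, hx⟩; exact Subtype.ext (h1 y hy x)
      · rintro y hy ⟨x, hx⟩; exact Subtype.ext (h2 y hy x)
      · rintro ⟨x, w, rfl⟩
        refine Subtype.ext ?_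
        change b • a • w = 0
        rw [smul_smul, mul_comm]; exact h3 w
      · intro y hy x
        obtain ⟨x, rfl⟩ := Submodule.Quotient.mk_surjective _ x
        rw [← Submodule.Quotient.mk_smul, h1 y hy x, Submodule.Quotient.mk_zero]
      · intro y hy x
        obtain ⟨x, rfl⟩ := Submodule.Quotient.mk_surjective _ x
        rw [← Submodule.Quotient.mk_smul, h2 y hy x, Submodule.Quotient.mk_zero]
      · intro x
        obtain ⟨x, rfl⟩ := Submodule.Quotient.mk_surjective _ x
        rw [← Submodule.Quotient.mk_smul, Submodule.Quotient.mk_eq_zero]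
        exact ⟨x, rfl⟩
    have gf : ∀ i ∈ Fᶜ, Good (f i) := by
      intro i hi N _ _ _ h1 h2 h3 j hj
      have hi' : i ∉ F := by simpa using hi
      refine ih (insert i F) ?_ N h1 ?_ j hj
      · have := Finset.card_insert_of_notMem hi'
        rw [Finset.card_compl] at hF ⊢
        omega
      · intro i' hi' x
        rcases Finset.mem_insert.1 hi' with rfl | h
        · exact h3 x
        · exact h2 _ h x
    have gg : Good (∏ i ∈ Fᶜ, f i) := Finset.prod_induction _ _ gmul gone gf
    have gp : ∀ a : ℕ, Good ((∏ i ∈ Fᶜ, f i) ^ a) := by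
      intro a
      induction a with
      | zero => simpa using gone
      | succ a iha => rw [pow_succ]; exact gmul _ _ iha gg
    intro N _ _ _ h1 h2 j hj
    refine subsingleton_of_forall_eq 0 fun e => ?_
    obtain ⟨a, ha⟩ := H F N h1 h2 j hj e
    have G := gp a
    set t := (∏ i ∈ Fᶜ, f i) ^ a
    let φ : N →ₗ[S] N := t • LinearMap.id
    have hex : Function.Exact (LinearMap.range φ).subtype (LinearMap.range φ).mkQ := fun x => by
      simp
    have hex2 : Function.Exact (LinearMap.ker φ).subtype φ.rangeRestrict := fun x => by
      simp [← Subtype.coe_inj]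
    have hcomp : (LinearMap.range φ).subtype ∘ₗ φ.rangeRestrict = t • LinearMap.id := by
      ext; rfl
    have hz : pullE φ.rangeRestrict (pullE (LinearMap.range φ).subtype e) = 0 := by
      rw [pullE_pull, hcomp, pullE_lsmul, ha]
    have hz2 := contra_inj (LinearMap.ker φ).subtype φ.rangeRestrict hex2
      (LinearMap.ker φ).injective_subtype φ.surjective_rangeRestrict (fun k hk => G _
        (by rintro y hy ⟨x, hx⟩; exact Subtype.ext (h1 y hy x))
        (by rintro y hy ⟨x, hx⟩; exact Subtype.ext (h2 y hy x))
        (by rintro ⟨x, hx⟩; exact Subtype.ext hx) k (by omega)) _ hz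
    obtain ⟨e', rfl⟩ := contra_two (LinearMap.range φ).subtype (LinearMap.range φ).mkQ hex
      (LinearMap.range φ).injective_subtype (Submodule.mkQ_surjective _) e hz2
    have : Subsingleton (EX S (N ⧸ LinearMap.range φ) S j) := by
      refine G _ ?_ ?_ ?_ j hj
      · intro y hy x
        obtain ⟨x, rfl⟩ := Submodule.Quotient.mk_surjective _ x
        rw [← Submodule.Quotient.mk_smul, h1 y hy x, Submodule.Quotient.mk_zero]
      · intro y hy x
        obtain ⟨x, rfl⟩ := Submodule.Quotient.mk_surjective _ x
        rw [← Submodule.Quotient.mk_smul, h2 y hy x, Submodule.Quotient.mk_zero]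
      · intro x
        obtain ⟨x, rfl⟩ := Submodule.Quotient.mk_surjective _ x
        rw [← Submodule.Quotient.mk_smul, Submodule.Quotient.mk_eq_zero]
        exact ⟨x, rfl⟩
    rw [this.elim e' 0, pullE_zero]

end TorsPart

section PolyPart

/-- Separate out the variable `t`. -/
noncomputable def sepV {σ : Type} [DecidableEq σ] (t : σ) :
    MvPolynomial σ ℂ →ₐ[ℂ] Polynomial (MvPolynomial σ ℂ) :=
  aeval (fun s => if s = t then Polynomial.X else Polynomial.C (X s))

/-- Polynomials not involving `t`. -/
noncomputable def NI {σ : Type} [DecidableEq σ] (t : σ) : Subalgebra ℂ (MvPolynomial σ ℂ) :=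
  AlgHom.equalizer (sepV t) (Polynomial.CAlgHom (R := ℂ) (A := MvPolynomial σ ℂ))

lemma NI_iff {σ : Type} [DecidableEq σ] {t : σ} {p : MvPolynomial σ ℂ} :
    p ∈ NI t ↔ sepV t p = Polynomial.C p := Iff.rfl

lemma NI_X {σ : Type} [DecidableEq σ] {t s : σ} (h : s ≠ t) : (X s : MvPolynomial σ ℂ) ∈ NI t := by
  rw [NI_iff]; simp [sepV, h]

lemma NI_C {σ : Type} [DecidableEq σ] (t : σ) (z : ℂ) : (C z : MvPolynomial σ ℂ) ∈ NI t :=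
  (NI t).algebraMap_mem z

lemma sepV_eval {σ : Type} [DecidableEq σ] (t : σ) (p : MvPolynomial σ ℂ) :
    (sepV t p).eval (X t) = p := by
  have : ((Polynomial.aeval (X t : MvPolynomial σ ℂ)).restrictScalars ℂ).comp (sepV t)
      = AlgHom.id ℂ _ := by
    apply MvPolynomial.algHom_ext
    intro s
    by_cases h : s = t <;> simp [sepV, h]
  have := DFunLike.congr_fun this p
  simpa [Polynomial.aeval_def] using this

lemma poly_reg {A : Type} [CommRing A] (𝔞 : Ideal A) (u w : A) (M : Polynomial A)
    (h : ∀ k, u * M.coeff k + w * M.coeff (k + 1) ∈ 𝔞) :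
    ∀ j k, M.natDegree + 1 ≤ k + j → u ^ j * M.coeff k ∈ 𝔞 := by
  intro j
  induction j with
  | zero =>
    intro k hk
    rw [Polynomial.coeff_eq_zero_of_natDegree_lt (by omega)]
    simp
  | succ j ih =>
    intro k hk
    have h1 := ih (k + 1) (by omega)
    have : u ^ (j + 1) * M.coeff k =
      u ^ j * (u * M.coeff k + w * M.coeff (k + 1)) - w * (u ^ j * M.coeff (k + 1)) := by ring
    rw [this]
    exact sub_mem (Ideal.mul_mem_left _ _ (h k)) (Ideal.mul_mem_left _ _ h1)

lemma var_reg {σ : Type} [DecidableEq σ] (t : σ) (G : Set (MvPolynomial σ ℂ))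
    (hG : ∀ p ∈ G, p ∈ NI t) (u w m : MvPolynomial σ ℂ) (hu : u ∈ NI t) (hw : w ∈ NI t)
    (h : (u * X t + w) * m ∈ Ideal.span G) : ∃ a : ℕ, u ^ a * m ∈ Ideal.span G := by
  have key : ∀ p ∈ Ideal.span G, ∀ k, (sepV t p).coeff k ∈ Ideal.span G := by
    intro p hp
    rw [← Ideal.mem_map_C_iff]
    have : Ideal.map (sepV t) (Ideal.span G) ≤ Ideal.map Polynomial.C (Ideal.span G) := by
      rw [Ideal.map_span, Ideal.span_le]
      rintro _ ⟨q, hq, rfl⟩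
      have := hG q hq
      rw [NI_iff] at this
      rw [this]
      exact Ideal.mem_map_of_mem _ (Ideal.subset_span hq)
    exact this (Ideal.mem_map_of_mem _ hp)
  have h1 := key _ h
  rw [NI_iff] at hu hw
  have hX : sepV t (X t) = Polynomial.X := by simp [sepV]
  rw [map_mul, map_add, map_mul, hu, hw, hX] at h1
  have h2 : ∀ k, u * (sepV t m).coeff k + w * (sepV t m).coeff (k + 1) ∈ Ideal.span G := by
    intro k
    have := h1 (k + 1)
    rw [add_mul, mul_assoc, Polynomial.coeff_add, Polynomial.coeff_C_mul, Polynomial.coeff_C_mul,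
      Polynomial.coeff_X_mul] at this
    exact this
  refine ⟨(sepV t m).natDegree + 1, ?_⟩
  have h3 := poly_reg _ u w _ h2 ((sepV t m).natDegree + 1)
  nth_rewrite 2 [← sepV_eval t m]
  rw [Polynomial.eval_eq_sum, Polynomial.sum, Finset.mul_sum]
  refine sum_mem fun k _ => ?_
  rw [← mul_assoc]
  exact Ideal.mul_mem_right _ _ (h3 k (by omega))

lemma QR_vars {σ : Type} [DecidableEq σ] (g : MvPolynomial σ ℂ) (y u w : σ → MvPolynomial σ ℂ)
    (L : List σ) : ∀ (G : Set (MvPolynomial σ ℂ)),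
    (∀ t ∈ L, y t = u t * X t + w t ∧ u t ∈ NI t ∧ w t ∈ NI t ∧ u t ∣ g) →
    (∀ t ∈ L, ∀ p ∈ G, p ∈ NI t) → L.Pairwise (fun s t => y s ∈ NI t) →
    QR g (Ideal.span G) (L.map y) := by
  induction L with
  | nil => intros; trivial
  | cons t L ih =>
    intro G h1 h2 h3
    rw [List.pairwise_cons] at h3
    refine ⟨?_, ?_⟩
    · intro m hm
      obtain ⟨e, hu, hw, hg⟩ := h1 t (by simp)
      rw [e] at hm
      obtain ⟨a, ha⟩ := var_reg t G (h2 t (by simp)) _ _ m hu hw hm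
      refine ⟨a, ?_⟩
      obtain ⟨b, rfl⟩ := hg
      rw [mul_pow, mul_comm (u t ^ a), mul_assoc]
      exact Ideal.mul_mem_left _ _ ha
    · rw [← Ideal.span_union]
      refine ih _ (fun s hs => h1 s (by simp [hs])) ?_ h3.2
      intro s hs p hp
      rcases hp with hp | hp
      · exact h2 s (by simp [hs]) p hp
      · rw [Set.mem_singleton_iff] at hp
        rw [hp]; exact h3.1 s hs

lemma dualpick {W ι : Type} [AddCommGroup W] [Module ℂ W] [FiniteDimensional ℂ W] [Fintype ι]
    [DecidableEq ι]
    (φ : ι → Module.Dual ℂ W) (h : ∀ w, (∀ i, φ i w = 0) → w = 0) :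
    ∃ (J : Finset ι) (v : ι → W), J.card = Module.finrank ℂ W ∧
      ∀ i ∈ J, ∀ k ∈ J, φ k (v i) = if k = i then 1 else 0 := by
  have hsp : Submodule.span ℂ (Set.range φ) = ⊤ := by
    rw [← Subspace.dualCoannihilator_dualAnnihilator_eq (W := Submodule.span ℂ (Set.range φ))]
    rw [show (Submodule.span ℂ (Set.range φ)).dualCoannihilator = ⊥ from ?_]
    · simp
    · rw [eq_bot_iff]
      intro w hw
      rw [Submodule.mem_dualCoannihilator] at hw
      exact h w fun i => hw _ (Submodule.subset_span ⟨i, rfl⟩)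
  obtain ⟨κ, a, ha, hs, hl⟩ := exists_linearIndependent' ℂ φ
  have : Finite κ := Finite.of_injective a ha
  have := Fintype.ofFinite κ
  classical
  let b : Module.Basis κ ℂ (Module.Dual ℂ W) := Module.Basis.mk hl (by rw [hs, hsp])
  let d : κ → W := fun k => (Module.evalEquiv ℂ W).symm (b.dualBasis k)
  have hd : ∀ i k, φ (a k) (d i) = if k = i then 1 else 0 := by
    intro i k
    have e1 : φ (a k) = b k := by simp [b]
    have e2 : φ (a k) (d i) = b.dualBasis i (b k) := by
      rw [e1]
      simp [d]
    rw [e2, Module.Basis.dualBasis_apply_self]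
  by_cases hκ : Nonempty κ
  · refine ⟨Finset.univ.image a, fun i => d (Function.invFun a i), ?_, ?_⟩
    · rw [Finset.card_image_of_injective _ ha, Finset.card_univ, ← Module.finrank_eq_card_basis b,
        Subspace.dual_finrank_eq]
    · intro i hi k hk
      obtain ⟨i, -, rfl⟩ := Finset.mem_image.1 hi
      obtain ⟨k, -, rfl⟩ := Finset.mem_image.1 hk
      change φ (a k) (d (Function.invFun a (a i))) = _
      rw [Function.leftInverse_invFun ha i, hd]
      simp [ha.eq_iff]
  · refine ⟨∅, 0, ?_, by simp⟩
    have := not_nonempty_iff.1 hκ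
    rw [← Subspace.dual_finrank_eq, Module.finrank_eq_card_basis b]
    simp

end PolyPart

section GradePart

variable {ℓ n : ℕ}

/-- linear form with coefficient vector w -/
noncomputable def Lw (n : ℕ) (w : Fin ℓ → ℂ) : MvPolynomial (Fin n ⊕ Fin ℓ) ℂ :=
  ∑ j, C (w j) * X (Sum.inr j)

/-- pairing -/
def evv (c : Fin n → Fin ℓ → ℂ) (i : Fin n) (v : Fin ℓ → ℂ) : ℂ := ∑ j, c i j * v j

open Classical in
/-- hyperplanes not containing v -/
noncomputable def Sv (c : Fin n → Fin ℓ → ℂ) (v : Fin ℓ → ℂ) : Finset (Fin n) :=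
  univ.filter (fun i => evv c i v ≠ 0)

/-- explicit elements of the log ideal -/
noncomputable def hv (c : Fin n → Fin ℓ → ℂ) (v : Fin ℓ → ℂ) : MvPolynomial (Fin n ⊕ Fin ℓ) ℂ :=
  ∑ i ∈ Sv c v, C (evv c i v) * (∏ k ∈ (Sv c v).erase i, fS c k) * X (Sum.inl i)

lemma pderiv_fS (c : Fin n → Fin ℓ → ℂ) (i : Fin n) (j : Fin ℓ) :
    pderiv (Sum.inr j) (fS c i) = C (c i j) := by
  classical
  simp only [fS, map_sum, Derivation.leibniz, pderiv_C, pderiv_X, smul_eq_mul, mul_zero, add_zero]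
  rw [Finset.sum_eq_single j]
  · simp
  · intro b _ hb
    simp [hb.symm]
  · simp

lemma der_prod {A : Type} [CommRing A] {σ : Type} (s : σ) {ι : Type} [DecidableEq ι]
    (T : Finset ι) (f : ι → MvPolynomial σ A) :
    pderiv s (∏ i ∈ T, f i) = ∑ i ∈ T, (∏ k ∈ T.erase i, f k) * pderiv s (f i) := by
  induction T using Finset.induction_on with
  | empty => simp
  | insert a T ha ih =>
    rw [Finset.prod_insert ha, Derivation.leibniz, ih, Finset.sum_insert ha,
      Finset.erase_insert ha, smul_eq_mul, smul_eq_mul, Finset.mul_sum, add_comm]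
    congr 1
    refine Finset.sum_congr rfl fun i hi => ?_
    have : i ≠ a := fun h => ha (h ▸ hi)
    rw [Finset.erase_insert_of_ne this.symm, Finset.prod_insert (by simp [ha])]
    ring

lemma pderiv_QS (c : Fin n → Fin ℓ → ℂ) (j : Fin ℓ) :
    pderiv (Sum.inr j) (QS c) = ∑ i, Qdiv c i * C (c i j) := by
  rw [QS, der_prod]
  simp only [pderiv_fS, Qdiv]

lemma QS_eq (c : Fin n → Fin ℓ → ℂ) (i : Fin n) : QS c = fS c i * Qdiv c i :=
  (Finset.mul_prod_erase _ _ (Finset.mem_univ i)).symm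

/-- θ(f_i) -/
noncomputable def thf (c : Fin n → Fin ℓ → ℂ) (θ : Fin ℓ → MvPolynomial (Fin n ⊕ Fin ℓ) ℂ)
    (i : Fin n) : MvPolynomial (Fin n ⊕ Fin ℓ) ℂ := ∑ j, θ j * C (c i j)

lemma theta_Q (c : Fin n → Fin ℓ → ℂ) (θ : Fin ℓ → MvPolynomial (Fin n ⊕ Fin ℓ) ℂ) :
    ∑ j, θ j * pderiv (Sum.inr j) (QS c) = ∑ i, Qdiv c i * thf c θ i := by
  simp only [pderiv_QS, thf, Finset.mul_sum]
  rw [Finset.sum_comm]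
  exact Finset.sum_congr rfl fun i _ => Finset.sum_congr rfl fun j _ => by ring

lemma pairs_iff (c : Fin n → Fin ℓ → ℂ) (θ : Fin ℓ → MvPolynomial (Fin n ⊕ Fin ℓ) ℂ)
    (g : MvPolynomial (Fin n ⊕ Fin ℓ) ℂ) :
    PairsWith c θ g ↔ QS c * g = ∑ i, X (Sum.inl i) * Qdiv c i * thf c θ i := by
  simp only [PairsWith, pderiv_fS, thf]

lemma logder_of (c : Fin n → Fin ℓ → ℂ) (θ : Fin ℓ → MvPolynomial (Fin n ⊕ Fin ℓ) ℂ)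
    (h : ∀ i, fS c i ∣ thf c θ i) : IsLogDer c θ := by
  rw [IsLogDer, theta_Q]
  refine sum_mem fun i _ => ?_
  rw [Ideal.mem_span_singleton, QS_eq c i, mul_comm]
  exact mul_dvd_mul_left _ (h i)

lemma hv_mem (c : Fin n → Fin ℓ → ℂ) (v : Fin ℓ → ℂ) : hv c v ∈ Ilog c := by
  classical
  let θ : Fin ℓ → MvPolynomial (Fin n ⊕ Fin ℓ) ℂ := fun j => (∏ k ∈ Sv c v, fS c k) * C (v j)
  have hθ : ∀ i, thf c θ i = (∏ k ∈ Sv c v, fS c k) * C (evv c i v) := by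
    intro i
    simp only [thf, θ, evv, map_sum, map_mul, Finset.mul_sum]
    exact Finset.sum_congr rfl fun j _ => by ring
  refine Ideal.subset_span ⟨θ, logder_of c θ ?_, ?_⟩
  · intro i
    rw [hθ]
    by_cases h : i ∈ Sv c v
    · exact Dvd.dvd.mul_right (Finset.dvd_prod_of_mem _ h) _
    · have : evv c i v = 0 := by simpa [Sv] using h
      simp [this]
  · rw [pairs_iff, hv, Finset.mul_sum]
    simp only [hθ]
    rw [← Finset.sum_subset (Finset.subset_univ (Sv c v))]
    · refine Finset.sum_congr rfl fun i hi => ?_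
      rw [QS_eq c i, ← Finset.mul_prod_erase _ _ hi]
      ring
    · intro i _ h
      have : evv c i v = 0 := by simpa [Sv] using h
      simp [this]

lemma NI_Lw (w : Fin ℓ → ℂ) (k : Fin ℓ) (h : w k = 0) :
    Lw n w ∈ NI (Sum.inr k : Fin n ⊕ Fin ℓ) := by
  refine Subalgebra.sum_mem _ fun j _ => ?_
  by_cases hj : j = k
  · subst hj; simp [h]
  · exact Subalgebra.mul_mem _ (NI_C _ _) (NI_X (by simpa using hj))

lemma NI_Lw' (w : Fin ℓ → ℂ) (k : Fin n) :
    Lw n w ∈ NI (Sum.inl k : Fin n ⊕ Fin ℓ) :=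
  Subalgebra.sum_mem _ fun j _ => Subalgebra.mul_mem _ (NI_C _ _) (NI_X (by simp))

lemma fS_Lw (c : Fin n → Fin ℓ → ℂ) (i : Fin n) : fS c i = Lw n (c i) := rfl

lemma Lw_split (w : Fin ℓ → ℂ) (k : Fin ℓ) (h : w k = 1) :
    Lw n w = 1 * X (Sum.inr k) + Lw n (Function.update w k 0) := by
  classical
  rw [Lw, Lw, ← Finset.add_sum_erase _ _ (mem_univ k),
    ← Finset.add_sum_erase univ (fun j => C (Function.update w k 0 j) * _) (mem_univ k)]
  simp only [h, Function.update_self, map_one, map_zero, zero_mul, zero_add]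
  congr 1
  refine Finset.sum_congr rfl fun j hj => ?_
  rw [Function.update_of_ne (Finset.ne_of_mem_erase hj)]

lemma hv_split (c : Fin n → Fin ℓ → ℂ) (v : Fin ℓ → ℂ) (k : Fin n) (h : evv c k v = 1) :
    ∃ u w, hv c v = u * X (Sum.inl k) + w ∧ u ∈ NI (Sum.inl k : Fin n ⊕ Fin ℓ) ∧
      w ∈ NI (Sum.inl k : Fin n ⊕ Fin ℓ) ∧ u ∣ ∏ i ∈ Sv c v, fS c i := by
  classical
  have hk : k ∈ Sv c v := by simp [Sv, h]
  refine ⟨_, _, (Finset.add_sum_erase _ _ hk).symm, ?_, ?_, ?_⟩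
  · exact Subalgebra.mul_mem _ (NI_C _ _) (Subalgebra.prod_mem _ fun i _ => NI_Lw' _ _)
  · refine Subalgebra.sum_mem _ fun i hi => Subalgebra.mul_mem _ (Subalgebra.mul_mem _ (NI_C _ _)
      (Subalgebra.prod_mem _ fun i _ => NI_Lw' _ _)) (NI_X ?_)
    simpa using Finset.ne_of_mem_erase hi
  · rw [h, map_one, one_mul]
    exact Finset.prod_dvd_prod_of_subset _ _ _ (Finset.erase_subset _ _)

lemma NI_hv (c : Fin n → Fin ℓ → ℂ) (v : Fin ℓ → ℂ) (k : Fin n) (h : evv c k v = 0) :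
    hv c v ∈ NI (Sum.inl k : Fin n ⊕ Fin ℓ) := by
  refine Subalgebra.sum_mem _ fun i hi => Subalgebra.mul_mem _ (Subalgebra.mul_mem _ (NI_C _ _)
      (Subalgebra.prod_mem _ fun i _ => NI_Lw' _ _)) (NI_X ?_)
  rintro e
  have : i = k := by simpa using e
  subst this
  simp [Sv, h] at hi

lemma picks (c : Fin n → Fin ℓ → ℂ) (hess : Submodule.span ℂ (Set.range c) = ⊤)
    (F : Finset (Fin n)) :
    ∃ (J : Finset (Fin ℓ)) (K : Finset (Fin n)) (w : Fin ℓ → Fin ℓ → ℂ) (v : Fin n → Fin ℓ → ℂ),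
      J.card + K.card = ℓ ∧ (∀ j, w j ∈ Submodule.span ℂ (c '' F)) ∧
      (∀ i, ∀ k ∈ F, evv c k (v i) = 0) ∧
      (∀ i ∈ J, ∀ k ∈ J, w i k = if k = i then 1 else 0) ∧
      (∀ i ∈ K, ∀ k ∈ K, evv c k (v i) = if k = i then 1 else 0) := by
  classical
  let M : Matrix F (Fin ℓ) ℂ := Matrix.of fun i j => c i j
  let Xs := LinearMap.ker M.mulVecLin
  let W : Submodule ℂ (Fin ℓ → ℂ) := Submodule.span ℂ (c '' F)
  have hW : Module.finrank ℂ W = M.rank := by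
    rw [Matrix.rank_eq_finrank_span_row]
    have : W = Submodule.span ℂ (Set.range M.row) := by
      change Submodule.span ℂ (c '' F) = _
      rw [Set.image_eq_range]
      rfl
    rw [this]
  have hdim : Module.finrank ℂ W + Module.finrank ℂ Xs = ℓ := by
    rw [hW, Matrix.rank]
    have := LinearMap.finrank_range_add_finrank_ker M.mulVecLin
    simpa using this
  obtain ⟨J, w, hJ, hw⟩ := dualpick (W := W) (ι := Fin ℓ)
    (fun j => (LinearMap.proj j) ∘ₗ W.subtype) (by
      intro x hx
      ext j
      exact hx j)
  obtain ⟨K, v, hK, hv⟩ := dualpick (W := Xs) (ι := Fin n)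
    (fun i => (∑ j, c i j • LinearMap.proj j) ∘ₗ Xs.subtype) (by
      rintro ⟨x, hx⟩ h
      have h1 : ∀ i, evv c i x = 0 := by
        intro i
        have := h i
        simpa [evv] using this
      have h2 : ∀ z ∈ Submodule.span ℂ (Set.range c), ∑ j, z j * x j = 0 := by
        intro z hz
        induction hz using Submodule.span_induction with
        | mem z hz => obtain ⟨i, rfl⟩ := hz; exact h1 i
        | zero => simp
        | add a b _ _ ha hb => simp [add_mul, Finset.sum_add_distrib, ha, hb]
        | smul r a _ ha => simp [mul_assoc, ← Finset.mul_sum, ha]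
      ext j
      have := h2 (Pi.single j 1) (by rw [hess]; trivial)
      simpa [Pi.single_apply] using this)
  refine ⟨J, K, fun j => w j, fun i => v i, by rw [hJ, hK, hdim], fun j => (w j).2, ?_, ?_, ?_⟩
  · intro i k hk
    have := (v i).2
    have := congrFun (LinearMap.mem_ker.1 this) ⟨k, hk⟩
    exact this
  · intro i hi k hk
    exact hw i hi k hk
  · intro i hi k hk
    have := hv i hi k hk
    simpa [evv] using this

lemma grade_tors (c : Fin n → Fin ℓ → ℂ) (hess : Submodule.span ℂ (Set.range c) = ⊤)
    (F : Finset (Fin n)) (N : Type) [AddCommGroup N] [Module (MvPolynomial (Fin n ⊕ Fin ℓ) ℂ) N]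
    [Module.Finite (MvPolynomial (Fin n ⊕ Fin ℓ) ℂ) N]
    (hI : ∀ y ∈ Ilog c, ∀ x : N, y • x = 0) (hF : ∀ i ∈ F, ∀ x : N, fS c i • x = 0)
    (j : ℕ) (hj : j < ℓ)
    (e : EX (MvPolynomial (Fin n ⊕ Fin ℓ) ℂ) N (MvPolynomial (Fin n ⊕ Fin ℓ) ℂ) j) :
    ∃ a : ℕ, (∏ i ∈ Fᶜ, fS c i) ^ a • e = 0 := by
  classical
  obtain ⟨J, K, w, v, hcard, hw, hv0, hJ, hK⟩ := picks c hess F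
  let y : Fin n ⊕ Fin ℓ → MvPolynomial (Fin n ⊕ Fin ℓ) ℂ :=
    Sum.elim (fun i => hv c (v i)) (fun j => Lw n (w j))
  let L : List (Fin n ⊕ Fin ℓ) := J.toList.map Sum.inr ++ K.toList.map Sum.inl
  have hL : (L.map y).length = ℓ := by simp [L, hcard]
  have hdec : ∀ t, ∃ u z, t ∈ L → y t = u * X t + z ∧ u ∈ NI t ∧ z ∈ NI t ∧
      u ∣ ∏ i ∈ Fᶜ, fS c i := by
    intro t
    by_cases ht : t ∈ L
    · rcases t with i | j
      · have hi : i ∈ K := by simpa [L] using ht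
        obtain ⟨u, z, h1, h2, h3, h4⟩ := hv_split c (v i) i (by rw [hK i hi i hi, if_pos rfl])
        refine ⟨u, z, fun _ => ⟨h1, h2, h3, h4.trans ?_⟩⟩
        apply Finset.prod_dvd_prod_of_subset
        intro k hk
        rw [Finset.mem_compl]
        intro hkF
        simp [Sv, hv0 i k hkF] at hk
      · have hj : j ∈ J := by simpa [L] using ht
        refine ⟨_, _, fun _ => ⟨Lw_split (w j) j (by rw [hJ j hj j hj, if_pos rfl]),
          Subalgebra.one_mem _, NI_Lw _ _ (by simp), one_dvd _⟩⟩
    · exact ⟨0, 0, fun h => absurd h ht⟩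
  choose u z huz using hdec
  have hQR : QR (∏ i ∈ Fᶜ, fS c i) (Ideal.span ∅) (L.map y) := by
    refine QR_vars _ y u z L ∅ huz (by simp) ?_
    rw [List.pairwise_append, List.pairwise_map, List.pairwise_map]
    refine ⟨?_, ?_, ?_⟩
    · refine (List.Pairwise.and_mem.1 J.nodup_toList).imp ?_
      rintro a b ⟨ha, hb, hab⟩
      rw [Finset.mem_toList] at ha hb
      exact NI_Lw _ _ (by rw [hJ a ha b hb, if_neg (Ne.symm hab)])
    · refine (List.Pairwise.and_mem.1 K.nodup_toList).imp ?_
      rintro a b ⟨ha, hb, hab⟩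
      rw [Finset.mem_toList] at ha hb
      exact NI_hv _ _ _ (by rw [hK a ha b hb, if_neg (Ne.symm hab)])
    · intro a ha b hb
      obtain ⟨a, -, rfl⟩ := List.mem_map.1 ha
      obtain ⟨b, -, rfl⟩ := List.mem_map.1 hb
      exact NI_Lw' _ _
  have hkill : ∀ p ∈ L.map y, ∀ x : N, p • x = 0 := by
    intro p hp x
    obtain ⟨t, -, rfl⟩ := List.mem_map.1 hp
    rcases t with i | j
    · exact hI _ (hv_mem c (v i)) x
    · change Lw n (w j) • x = 0
      have := hw j
      generalize w j = z at this
      induction this using Submodule.span_induction with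
      | mem z hz => obtain ⟨i, hi, rfl⟩ := hz; exact hF i hi x
      | zero => simp [Lw]
      | add a b _ _ ha hb =>
        have : Lw n (a + b) = Lw n a + Lw n b := by
          simp [Lw, add_mul, Finset.sum_add_distrib]
        rw [this, add_smul, ha, hb, add_zero]
      | smul r a _ ha =>
        have : Lw n (r • a) = C r * Lw n a := by
          simp [Lw, Finset.mul_sum, mul_assoc]
        rw [this, mul_smul, ha, smul_zero]
  have T := QR_tors _ N (L.map y) _ hQR hkill j (by rw [hL]; exact hj)
  have hb : (Ideal.span ∅ : Ideal (MvPolynomial (Fin n ⊕ Fin ℓ) ℂ)) = ⊥ := Ideal.span_empty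
  let E := Submodule.quotEquivOfEqBot (Ideal.span ∅ : Ideal (MvPolynomial (Fin n ⊕ Fin ℓ) ℂ)) hb
  obtain ⟨a, ha⟩ := T (pushE E.symm.toLinearMap e)
  refine ⟨a, ?_⟩
  rw [← pushE_smul] at ha
  have h2 := congrArg (pushE E.toLinearMap) ha
  rw [pushE_push, pushE_zero] at h2
  have h3 : E.toLinearMap ∘ₗ E.symm.toLinearMap = (1 : MvPolynomial (Fin n ⊕ Fin ℓ) ℂ) • LinearMap.id := by
    rw [one_smul]; ext; simp
  rw [h3, pushE_lsmul, one_smul] at h2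
  exact h2

lemma grade_I (c : Fin n → Fin ℓ → ℂ) (hess : Submodule.span ℂ (Set.range c) = ⊤)
    (j : ℕ) (hj : j < ℓ) : Subsingleton (EX (MvPolynomial (Fin n ⊕ Fin ℓ) ℂ)
      (MvPolynomial (Fin n ⊕ Fin ℓ) ℂ ⧸ Ilog c) (MvPolynomial (Fin n ⊕ Fin ℓ) ℂ) j) := by
  refine descent (Ilog c) (fS c) (grade_tors c hess) _ ∅ rfl _ ?_ (by simp) j hj
  intro y hy x
  obtain ⟨x, rfl⟩ := Submodule.Quotient.mk_surjective _ x
  rw [← Submodule.Quotient.mk_smul, Submodule.Quotient.mk_eq_zero]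
  exact Ideal.mul_mem_right _ _ hy

end GradePart

section PdPart
open CategoryTheory CategoryTheory.Abelian

/-- projective dimension less than `m`. -/
abbrev HP (S : Type) [CommRing S] (m : ℕ) (M : Type) [AddCommGroup M] [Module S M] : Prop :=
  HasProjectiveDimensionLT (ModuleCat.of S M) m

variable {S : Type} [CommRing S]

lemma HP_equiv {m : ℕ} {M M' : Type} [AddCommGroup M] [Module S M] [AddCommGroup M'] [Module S M']
    (e : M ≃ₗ[S] M') (h : HP S m M) : HP S m M' :=
  hasProjectiveDimensionLT_of_iso e.toModuleIso m

lemma pdLE_HP (m : ℕ) : ∀ (M : Type) [AddCommGroup M] [Module S M], pdLE S m M → HP S (m+1) M := by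
  induction m with
  | zero =>
    intro M _ _ h
    have h' : Module.Projective S M := h
    exact projective_iff_hasProjectiveDimensionLT_one.1 ((IsProjective.iff_projective M).1 h')
  | succ m ih =>
    rintro M _ _ ⟨k, φ, hs, hk⟩
    have hse := scx_se (LinearMap.ker φ).subtype φ (LinearMap.exact_subtype_ker_map φ)
      (Submodule.subtype_injective _) hs
    exact (hse.hasProjectiveDimensionLT_X₃_iff m
      ((IsProjective.iff_projective (Fin k → S)).1 inferInstance)).2 (ih _ hk)

lemma HP_pdLE [IsNoetherianRing S] (m : ℕ) : ∀ (M : Type) [AddCommGroup M] [Module S M]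
    [Module.Finite S M], HP S (m+1) M → pdLE S m M := by
  induction m with
  | zero =>
    intro M _ _ _ h
    exact (IsProjective.iff_projective M).2 (projective_iff_hasProjectiveDimensionLT_one.2 h)
  | succ m ih =>
    intro M _ _ _ h
    obtain ⟨k, φ, hs⟩ := Module.Finite.exists_fin' S M
    refine ⟨k, φ, hs, ih _ ?_⟩
    have hse := scx_se (LinearMap.ker φ).subtype φ (LinearMap.exact_subtype_ker_map φ)
      (Submodule.subtype_injective _) hs
    exact (hse.hasProjectiveDimensionLT_X₃_iff m
      ((IsProjective.iff_projective (Fin k → S)).1 inferInstance)).1 h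

variable {N : Type} [AddCommGroup N] [Module S N]

lemma pushE_madd {A B : Type} [AddCommGroup A] [Module S A] [AddCommGroup B] [Module S B]
    {j : ℕ} (f g : A →ₗ[S] B) (e : EX S N A j) : pushE (f + g) e = pushE f e + pushE g e := by
  rw [pushE, ModuleCat.ofHom_add, Ext.mk₀_add, Ext.comp_add]; rfl

lemma pushE_mzero {A B : Type} [AddCommGroup A] [Module S A] [AddCommGroup B] [Module S B]
    {j : ℕ} (e : EX S N A j) : pushE (0 : A →ₗ[S] B) e = 0 := by
  have : ModuleCat.ofHom (0 : A →ₗ[S] B) = 0 := rfl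
  simp [pushE, this]

lemma pushE_msum {A B ι : Type} [AddCommGroup A] [Module S A] [AddCommGroup B] [Module S B]
    {j : ℕ} (s : Finset ι) (f : ι → A →ₗ[S] B) (e : EX S N A j) :
    pushE (∑ i ∈ s, f i) e = ∑ i ∈ s, pushE (f i) e := by
  classical
  induction s using Finset.induction_on with
  | empty => simp [pushE_mzero]
  | insert a s ha ih => rw [Finset.sum_insert ha, Finset.sum_insert ha, pushE_madd, ih]

lemma EX_free {j : ℕ} (h : Subsingleton (EX S N S j)) (k : ℕ) :
    Subsingleton (EX S N (Fin k → S) j) := by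
  refine subsingleton_of_forall_eq 0 fun e => ?_
  have h1 : (∑ i : Fin k, (LinearMap.single S (fun _ : Fin k => S) i) ∘ₗ (LinearMap.proj i))
      = (1 : S) • (LinearMap.id : (Fin k → S) →ₗ[S] (Fin k → S)) := by
    ext x i
    simp [Pi.single_apply]
  have h2 : e = pushE ((1 : S) • (LinearMap.id : (Fin k → S) →ₗ[S] (Fin k → S))) e := by
    rw [pushE_lsmul, one_smul]
  rw [h2, ← h1, pushE_msum]
  refine Finset.sum_eq_zero fun i _ => ?_
  rw [← pushE_push, show pushE (LinearMap.proj i : (Fin k → S) →ₗ[S] S) e = 0 from h.elim _ _,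
    pushE_zero]

lemma EX_pd [IsNoetherianRing S] (L : ℕ) (hN : ∀ j < L, Subsingleton (EX S N S j)) (p : ℕ) :
    ∀ (M : Type) [AddCommGroup M] [Module S M] [Module.Finite S M], pdLE S p M →
    ∀ j, j + p < L → Subsingleton (EX S N M j) := by
  induction p with
  | zero =>
    intro M _ _ _ h j hj
    have h' : Module.Projective S M := h
    obtain ⟨k, φ, hs⟩ := Module.Finite.exists_fin' S M
    obtain ⟨s, hs'⟩ := Module.projective_lifting_property φ LinearMap.id hs
    have hF := EX_free (hN j (by omega)) k
    refine subsingleton_of_forall_eq 0 fun e => ?_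
    have h2 : e = pushE φ (pushE s e) := by
      rw [pushE_push, hs', ← one_smul S LinearMap.id, pushE_lsmul, one_smul]
    rw [h2, show pushE s e = 0 from hF.elim _ _, pushE_zero]
  | succ p ih =>
    rintro M _ _ _ ⟨k, φ, hs, hk⟩ j hj
    exact cov_C (LinearMap.ker φ).subtype φ (LinearMap.exact_subtype_ker_map φ)
      (Submodule.subtype_injective _) hs (EX_free (hN j (by omega)) k)
      (ih _ hk (j+1) (by omega))

lemma EX0_hom {M : Type} [AddCommGroup M] [Module S M] (h : Subsingleton (EX S N M 0))
    (f : N →ₗ[S] M) : f = 0 := by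
  have : Ext.mk₀ (ModuleCat.ofHom f) = Ext.mk₀ (0 : ModuleCat.of S N ⟶ ModuleCat.of S M) := h.elim _ _
  have h2 := (Ext.mk₀_bijective _ _).1 this
  exact congrArg ModuleCat.Hom.hom h2

lemma EX_inj {A B : Type} [AddCommGroup A] [Module S A] [AddCommGroup B] [Module S B]
    (f : A →ₗ[S] B) (hf : Function.Injective f) (h : Subsingleton (EX S N B 0)) :
    Subsingleton (EX S N A 0) := by
  refine subsingleton_of_forall_eq 0 fun e => ?_
  have : Mono (ModuleCat.ofHom f) := (ModuleCat.mono_iff_injective _).2 hf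
  exact Ext.postcomp_mk₀_injective_of_mono (ModuleCat.of S N) (ModuleCat.ofHom f) (h.elim _ _)

/-- boundaries -/
def Bd {Ω : ℕ → Type} [∀ p, AddCommGroup (Ω p)] [∀ p, Module S (Ω p)]
    (d : ∀ p, Ω p →ₗ[S] Ω (p+1)) : ∀ p, Submodule S (Ω p)
  | 0 => ⊥
  | p+1 => LinearMap.range (d p)

lemma acyc (I : Ideal S) {Ω : ℕ → Type} [∀ p, AddCommGroup (Ω p)] [∀ p, Module S (Ω p)]
    (d : ∀ p, Ω p →ₗ[S] Ω (p+1)) (hdd : ∀ p x, d (p+1) (d p x) = 0) (L : ℕ)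
    (hkill : ∀ p < L, ∀ y ∈ I, ∀ z : Ω p, d p z = 0 → y • z ∈ Bd d p)
    (hext : ∀ p < L, ∀ j, j + p < L → Subsingleton (EX S (S ⧸ I) (Ω p) j))
    (hpd : ∀ p ≤ L, HP S (p+1) (Ω p)) (p : ℕ) : p ≤ L →
    (∀ j, j + p < L + 1 → Subsingleton (EX S (S ⧸ I) (Bd d p) j)) ∧ HP S p (Bd d p) := by
  induction p with
  | zero =>
    intro _
    have : Subsingleton (Bd d 0) := by change Subsingleton (⊥ : Submodule S (Ω 0)); infer_instance
    constructor
    · intro j _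
      refine subsingleton_of_forall_eq 0 fun e => ?_
      have h0 : (1:S) • (LinearMap.id : Bd d 0 →ₗ[S] Bd d 0) = 0 := Subsingleton.elim _ _
      have := pushE_lsmul e (1:S)
      rw [h0, pushE_mzero, one_smul] at this
      exact this.symm
    · exact Limits.IsZero.hasProjectiveDimensionLT_zero (ModuleCat.isZero_of_subsingleton _)
  | succ p ih =>
    intro hp
    obtain ⟨ih1, ih2⟩ := ih (by omega)
    have hBZ : Bd d p ≤ LinearMap.ker (d p) := by
      rcases p with _ | p
      · exact bot_le
      · rintro _ ⟨x, rfl⟩; exact hdd p x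
    have hZB : LinearMap.ker (d p) ≤ Bd d p := by
      let B' := (Bd d p).comap (LinearMap.ker (d p)).subtype
      let i : Bd d p →ₗ[S] LinearMap.ker (d p) := Submodule.inclusion hBZ
      have hex : Function.Exact i B'.mkQ := by
        intro x
        rw [Submodule.mkQ_apply, Submodule.Quotient.mk_eq_zero]
        constructor
        · intro hx; exact ⟨⟨x.1, hx⟩, rfl⟩
        · rintro ⟨y, rfl⟩; exact y.2
      have hH := cov_C (N := S ⧸ I) (j := 0) i B'.mkQ hex (Submodule.inclusion_injective _)
        (Submodule.mkQ_surjective _)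
        (EX_inj (LinearMap.ker (d p)).subtype (Submodule.subtype_injective _)
          (hext p (by omega) 0 (by omega)))
        (ih1 1 (by omega))
      intro z hz
      let z' : LinearMap.ker (d p) := ⟨z, hz⟩
      let g : (S ⧸ I) →ₗ[S] (LinearMap.ker (d p) ⧸ B') := Submodule.liftQ I
        (LinearMap.toSpanSingleton S _ (B'.mkQ z')) (by
          intro y hy
          rw [LinearMap.mem_ker, LinearMap.toSpanSingleton_apply, ← map_smul, Submodule.mkQ_apply,
            Submodule.Quotient.mk_eq_zero]
          exact hkill p (by omega) y hy z hz)
      have hg := congrArg (fun f => f (Submodule.Quotient.mk 1)) (EX0_hom hH g)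
      have hg2 : B'.mkQ z' = 0 := by
        have : g (Submodule.Quotient.mk 1) = (1:S) • B'.mkQ z' := rfl
        rw [one_smul] at this
        rw [← this]; exact hg
      rw [Submodule.mkQ_apply, Submodule.Quotient.mk_eq_zero] at hg2
      exact hg2
    have hex : Function.Exact (Bd d p).subtype (d p).rangeRestrict := by
      intro x
      constructor
      · intro hx
        exact ⟨⟨x, hZB (by simpa using congrArg Subtype.val hx)⟩, rfl⟩
      · rintro ⟨y, rfl⟩
        apply Subtype.ext
        exact hBZ y.2
    constructor
    · intro j hj
      exact cov_C _ _ hex (Submodule.subtype_injective _) (LinearMap.surjective_rangeRestrict _)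
        (hext p (by omega) j (by omega)) (ih1 (j+1) (by omega))
    · exact (scx_se _ _ hex (Submodule.subtype_injective _)
        (LinearMap.surjective_rangeRestrict _)).hasProjectiveDimensionLT_X₃ p ih2
        (hpd p (by omega))

lemma acyc_final (I : Ideal S) {Ω : ℕ → Type} [∀ p, AddCommGroup (Ω p)] [∀ p, Module S (Ω p)]
    (d : ∀ p, Ω p →ₗ[S] Ω (p+1)) (hdd : ∀ p x, d (p+1) (d p x) = 0) (L : ℕ)
    (hkill : ∀ p < L, ∀ y ∈ I, ∀ z : Ω p, d p z = 0 → y • z ∈ Bd d p)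
    (hext : ∀ p < L, ∀ j, j + p < L → Subsingleton (EX S (S ⧸ I) (Ω p) j))
    (hpd : ∀ p ≤ L, HP S (p+1) (Ω p)) : HP S (L+1) (Ω L ⧸ Bd d L) :=
  (scx_se _ _ (LinearMap.exact_subtype_mkQ (Bd d L)) (Submodule.subtype_injective _)
    (Submodule.mkQ_surjective _)).hasProjectiveDimensionLT_X₃ L
    (acyc I d hdd L hkill hext hpd L le_rfl).2 (hpd L le_rfl)

end PdPart

section ExtAlg
variable {ℓ : ℕ} {A : Type*} [CommRing A]

/-- sign -/
def sg (A : Type*) [CommRing A] (T : Finset (Fin ℓ)) (j : Fin ℓ) : A :=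
  (-1 : A) ^ ((T.filter (· < j)).card)

lemma sg_sq (T : Finset (Fin ℓ)) (j : Fin ℓ) : sg A T j * sg A T j = 1 := by
  rw [sg, ← pow_add, Even.neg_one_pow ⟨_, rfl⟩]

lemma sg_insert (T : Finset (Fin ℓ)) (j k : Fin ℓ) (hj : j ∉ T) :
    sg A (insert j T) k = (if j < k then -1 else 1) * sg A T k := by
  unfold sg
  rw [Finset.filter_insert]
  split_ifs with h
  · rw [Finset.card_insert_of_notMem (by simp [hj]), pow_succ]; ring
  · simp

lemma sg_erase (T : Finset (Fin ℓ)) (j k : Fin ℓ) (hj : j ∈ T) :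
    sg A T k = (if j < k then -1 else 1) * sg A (T.erase j) k := by
  rw [← sg_insert _ _ _ (Finset.notMem_erase j T), Finset.insert_erase hj]

lemma wedge1_def (v : Fin ℓ → A) (μ : Finset (Fin ℓ) → A) (T : Finset (Fin ℓ)) :
    wedge1 v μ T = ∑ j ∈ T, sg A T j * v j * μ (T.erase j) := rfl

lemma wedge1_anti (v w : Fin ℓ → A) (μ : Finset (Fin ℓ) → A) (T : Finset (Fin ℓ)) :
    wedge1 v (wedge1 w μ) T = - wedge1 w (wedge1 v μ) T := by
  simp only [wedge1_def, Finset.mul_sum]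
  rw [← Finset.sum_neg_distrib]
  simp only [← Finset.sum_neg_distrib]
  rw [Finset.sum_sigma', Finset.sum_sigma']
  refine Finset.sum_bij' (fun x _ => ⟨x.2, x.1⟩) (fun x _ => ⟨x.2, x.1⟩) ?_ ?_ ?_ ?_ ?_
  · rintro ⟨j, k⟩ h
    simp only [Finset.mem_sigma, Finset.mem_erase] at h ⊢
    exact ⟨h.2.2, Ne.symm h.2.1, h.1⟩
  · rintro ⟨j, k⟩ h
    simp only [Finset.mem_sigma, Finset.mem_erase] at h ⊢
    exact ⟨h.2.2, Ne.symm h.2.1, h.1⟩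
  · rintro ⟨j, k⟩ h; rfl
  · rintro ⟨j, k⟩ h; rfl
  · rintro ⟨j, k⟩ h
    simp only [Finset.mem_sigma, Finset.mem_erase] at h
    obtain ⟨hj, hkj, hk⟩ := h
    dsimp only
    rw [Finset.erase_right_comm, sg_erase T j k hj, sg_erase T k j hk]
    rcases lt_or_gt_of_ne hkj with h | h
    · rw [if_pos h, if_neg (not_lt.2 h.le)]; ring
    · rw [if_pos h, if_neg (not_lt.2 h.le)]; ring

/-- contraction -/
def ctr (θ : Fin ℓ → A) (μ : Finset (Fin ℓ) → A) (T : Finset (Fin ℓ)) : A :=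
  ∑ j ∈ Tᶜ, sg A T j * θ j * μ (insert j T)

lemma ctr_wedge (θ v : Fin ℓ → A) (μ : Finset (Fin ℓ) → A) (T : Finset (Fin ℓ)) :
    ctr θ (wedge1 v μ) T + wedge1 v (ctr θ μ) T = (∑ j, θ j * v j) * μ T := by
  have h1 : ctr θ (wedge1 v μ) T = (∑ j ∈ Tᶜ, θ j * v j * μ T) + ∑ j ∈ Tᶜ, ∑ k ∈ T,
      sg A T j * θ j * (sg A (insert j T) k * v k * μ ((insert j T).erase k)) := by
    unfold ctr
    rw [← Finset.sum_add_distrib]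
    refine Finset.sum_congr rfl fun j hj => ?_
    have hj' : j ∉ T := by simpa using hj
    rw [wedge1_def, Finset.sum_insert hj', mul_add, Finset.erase_insert hj', sg_insert _ _ _ hj',
      if_neg (lt_irrefl _), Finset.mul_sum]
    congr 1
    linear_combination (θ j * v j * μ T) * sg_sq (A := A) T j
  have h2 : wedge1 v (ctr θ μ) T = (∑ k ∈ T, θ k * v k * μ T) + ∑ k ∈ T, ∑ j ∈ Tᶜ,
      sg A T k * v k * (sg A (T.erase k) j * θ j * μ (insert j (T.erase k))) := by
    rw [wedge1_def, ← Finset.sum_add_distrib]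
    refine Finset.sum_congr rfl fun k hk => ?_
    have : (T.erase k)ᶜ = insert k Tᶜ := by
      ext x; simp only [Finset.mem_compl, Finset.mem_erase, Finset.mem_insert]; tauto
    rw [ctr, this, Finset.sum_insert (by simpa using hk), mul_add, Finset.insert_erase hk,
      Finset.mul_sum]
    congr 1
    have h3 := sg_erase (A := A) T k k hk
    rw [if_neg (lt_irrefl _), one_mul] at h3
    rw [← h3]
    linear_combination (θ k * v k * μ T) * sg_sq (A := A) T k
  rw [h1, h2, Finset.sum_comm (s := T) (t := Tᶜ)]
  have h3 : (∑ j ∈ Tᶜ, ∑ k ∈ T,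
      sg A T j * θ j * (sg A (insert j T) k * v k * μ ((insert j T).erase k))) +
      ∑ j ∈ Tᶜ, ∑ k ∈ T,
      sg A T k * v k * (sg A (T.erase k) j * θ j * μ (insert j (T.erase k))) = 0 := by
    rw [← Finset.sum_add_distrib]
    refine Finset.sum_eq_zero fun j hj => ?_
    rw [← Finset.sum_add_distrib]
    refine Finset.sum_eq_zero fun k hk => ?_
    have hj' : j ∉ T := by simpa using hj
    have hjk : j ≠ k := fun h => hj' (h ▸ hk)
    rw [Finset.erase_insert_of_ne hjk, sg_insert _ _ _ hj', sg_erase T k j hk]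
    rcases lt_or_gt_of_ne hjk with h | h
    · rw [if_pos h, if_neg (not_lt.2 h.le)]; ring
    · rw [if_pos h, if_neg (not_lt.2 h.le)]; ring
  rw [Finset.sum_mul, ← Finset.sum_add_sum_compl T]
  linear_combination h3

lemma wedge1_vsum {ι : Type*} (s : Finset ι) (r : ι → A) (v : ι → Fin ℓ → A)
    (μ : Finset (Fin ℓ) → A) (T : Finset (Fin ℓ)) :
    wedge1 (fun j => ∑ i ∈ s, r i * v i j) μ T = ∑ i ∈ s, r i * wedge1 (v i) μ T := by
  simp only [wedge1_def, Finset.mul_sum, Finset.sum_mul]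
  rw [Finset.sum_comm]
  refine Finset.sum_congr rfl fun i _ => Finset.sum_congr rfl fun j _ => by ring

lemma wedge1_smul' (v : Fin ℓ → A) (r : A) (a : Finset (Fin ℓ) → A) (T : Finset (Fin ℓ)) :
    wedge1 v (fun T => r * a T) T = r * wedge1 v a T := wedge1_smul v r a T

lemma ctr_smul' (v : Fin ℓ → A) (r : A) (a : Finset (Fin ℓ) → A) (T : Finset (Fin ℓ)) :
    ctr v (fun T => r * a T) T = r * ctr v a T := by
  simp only [ctr, Finset.mul_sum]
  exact Finset.sum_congr rfl (fun j _ => by ring)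

lemma wedge1_card (v : Fin ℓ → A) (μ : Finset (Fin ℓ) → A) (p : ℕ)
    (h : ∀ T, T.card ≠ p → μ T = 0) (T : Finset (Fin ℓ)) (hT : T.card ≠ p + 1) :
    wedge1 v μ T = 0 := by
  rw [wedge1_def]
  refine Finset.sum_eq_zero fun j hj => ?_
  rw [h, mul_zero]
  have := Finset.card_erase_add_one hj
  omega

lemma ctr_card (v : Fin ℓ → A) (μ : Finset (Fin ℓ) → A) (p : ℕ)
    (h : ∀ T, T.card ≠ p + 1 → μ T = 0) (T : Finset (Fin ℓ)) (hT : T.card ≠ p) :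
    ctr v μ T = 0 := by
  refine Finset.sum_eq_zero fun j hj => ?_
  rw [h, mul_zero]
  rw [Finset.card_insert_of_notMem (by simpa using hj)]
  omega

end ExtAlg

section LogS
variable {ℓ n : ℕ}

lemma fS_ne (c : Fin n → Fin ℓ → ℂ) (hnz : ∀ i, c i ≠ 0) (i : Fin n) : fS c i ≠ 0 := by
  intro h
  apply hnz i
  funext j
  have := pderiv_fS c i j
  rw [h, map_zero] at this
  exact (C_eq_zero.1 this.symm)

lemma fS_prime (c : Fin n → Fin ℓ → ℂ) (hnz : ∀ i, c i ≠ 0) (i : Fin n) : Prime (fS c i) := by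
  rw [← irreducible_iff_prime]
  have hne := fS_ne c hnz i
  apply irreducible_of_totalDegree_eq_one
  · apply le_antisymm
    · apply totalDegree_finsetSum_le
      intro j _
      refine (totalDegree_mul _ _).trans ?_
      simp
    · rw [Nat.one_le_iff_ne_zero]
      intro h
      rw [totalDegree_eq_zero_iff_eq_C] at h
      apply hnz i
      funext j
      have := pderiv_fS c i j
      rw [h, pderiv_C] at this
      exact (C_eq_zero.1 this.symm)
  · intro x hx
    rw [isUnit_iff_ne_zero]
    rintro rfl
    apply hne
    ext m
    simpa using hx m

lemma fS_ndvd (c : Fin n → Fin ℓ → ℂ)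
    (hprop : ∀ i k, i ≠ k → ∀ t : ℂ, c i ≠ t • c k) (i k : Fin n) (h : i ≠ k) :
    ¬ fS c i ∣ fS c k := by
  rintro ⟨g, hg⟩
  apply hprop k i h.symm (constantCoeff g)
  funext j
  have := congrArg (fun q => constantCoeff (pderiv (Sum.inr j) q)) hg
  simp only [Derivation.leibniz, pderiv_fS, map_add, smul_eq_mul, map_mul, constantCoeff_C] at this
  rw [this]
  simp [fS]

lemma QS_ne (c : Fin n → Fin ℓ → ℂ) (hnz : ∀ i, c i ≠ 0) : QS c ≠ 0 :=
  Finset.prod_ne_zero_iff.2 fun i _ => fS_ne c hnz i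

lemma Qdvd (c : Fin n → Fin ℓ → ℂ) (hnz : ∀ i, c i ≠ 0)
    (hprop : ∀ i k, i ≠ k → ∀ t : ℂ, c i ≠ t • c k) (t : Fin n → MvPolynomial (Fin n ⊕ Fin ℓ) ℂ) :
    QS c ∣ ∑ i, Qdiv c i * t i ↔ ∀ i, fS c i ∣ t i := by
  constructor
  · intro h i
    have hp := fS_prime c hnz i
    have h1 : fS c i ∣ ∑ i, Qdiv c i * t i := (Dvd.intro _ (QS_eq c i).symm).trans h
    rw [← Finset.add_sum_erase _ _ (Finset.mem_univ i)] at h1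
    rw [dvd_add_left] at h1
    · refine (hp.dvd_or_dvd h1).resolve_left ?_
      rw [Qdiv, hp.dvd_finsetProd_iff]
      rintro ⟨k, hk, hd⟩
      exact fS_ndvd c hprop i k (Ne.symm (Finset.ne_of_mem_erase hk)) hd
    · refine Finset.dvd_sum fun k hk => Dvd.dvd.mul_right ?_ _
      exact Finset.dvd_prod_of_mem _ (Finset.mem_erase.2 ⟨(Finset.ne_of_mem_erase hk).symm,
        Finset.mem_univ _⟩)
  · intro h
    refine Finset.dvd_sum fun i _ => ?_
    obtain ⟨g, hg⟩ := h i
    refine ⟨g, ?_⟩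
    rw [hg, QS_eq c i]; ring

/-- log forms over `S`. -/
noncomputable def OmS (c : Fin n → Fin ℓ → ℂ) (p : ℕ) :
    Submodule (MvPolynomial (Fin n ⊕ Fin ℓ) ℂ) (Finset (Fin ℓ) → MvPolynomial (Fin n ⊕ Fin ℓ) ℂ) where
  carrier := {μ | (∀ T, T.card ≠ p → μ T = 0) ∧
    ∀ T, QS c ∣ wedge1 (fun j => pderiv (Sum.inr j) (QS c)) μ T}
  add_mem' := by
    rintro a b ⟨ha1, ha2⟩ ⟨hb1, hb2⟩
    refine ⟨fun T hT => by simp [Pi.add_apply, ha1 T hT, hb1 T hT], fun T => ?_⟩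
    rw [wedge1_add]
    exact dvd_add (ha2 T) (hb2 T)
  zero_mem' := ⟨fun _ _ => rfl, fun T => by simp [wedge1]⟩
  smul_mem' := by
    rintro r a ⟨ha1, ha2⟩
    refine ⟨fun T hT => by simp [ha1 T hT], fun T => ?_⟩
    rw [wedge1_smul]
    exact Dvd.dvd.mul_left (ha2 T) r

/-- coordinates of `df_i` -/
noncomputable def cS (c : Fin n → Fin ℓ → ℂ) (i : Fin n) (j : Fin ℓ) :
    MvPolynomial (Fin n ⊕ Fin ℓ) ℂ := C (c i j)

lemma wedge_dQ (c : Fin n → Fin ℓ → ℂ) (μ : Finset (Fin ℓ) → MvPolynomial (Fin n ⊕ Fin ℓ) ℂ)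
    (T : Finset (Fin ℓ)) : wedge1 (fun j => pderiv (Sum.inr j) (QS c)) μ T =
      ∑ i, Qdiv c i * wedge1 (cS c i) μ T := by
  have h : (fun j => pderiv (Sum.inr j) (QS c)) = fun j => ∑ i, Qdiv c i * cS c i j := by
    funext j
    rw [pderiv_QS]; rfl
  rw [← wedge1_vsum, h]

lemma wedge_Qd (c : Fin n → Fin ℓ → ℂ) (μ : Finset (Fin ℓ) → MvPolynomial (Fin n ⊕ Fin ℓ) ℂ)
    (T : Finset (Fin ℓ)) : wedge1 (Qd c) μ T =
      ∑ i, (X (Sum.inl i) * Qdiv c i) * wedge1 (cS c i) μ T := by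
  have h : Qd c = fun j => ∑ i, (X (Sum.inl i) * Qdiv c i) * cS c i j := by
    funext j
    rw [Qd]
    refine Finset.sum_congr rfl fun i _ => ?_
    rw [cS]; ring
  rw [← wedge1_vsum, h]

lemma mem_OmS (c : Fin n → Fin ℓ → ℂ) (hnz : ∀ i, c i ≠ 0)
    (hprop : ∀ i k, i ≠ k → ∀ t : ℂ, c i ≠ t • c k) (p : ℕ)
    (μ : Finset (Fin ℓ) → MvPolynomial (Fin n ⊕ Fin ℓ) ℂ) :
    μ ∈ OmS c p ↔ (∀ T, T.card ≠ p → μ T = 0) ∧ ∀ i T, fS c i ∣ wedge1 (cS c i) μ T := by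
  change (_ ∧ _) ↔ _
  simp only [wedge_dQ, Qdvd c hnz hprop]
  rw [forall_comm]

lemma log_iff (c : Fin n → Fin ℓ → ℂ) (hnz : ∀ i, c i ≠ 0)
    (hprop : ∀ i k, i ≠ k → ∀ t : ℂ, c i ≠ t • c k) 
    (θ : Fin ℓ → MvPolynomial (Fin n ⊕ Fin ℓ) ℂ) :
    IsLogDer c θ ↔ ∀ i, fS c i ∣ thf c θ i := by
  rw [IsLogDer, theta_Q, Ideal.mem_span_singleton, Qdvd c hnz hprop]

/-- exact division -/
noncomputable def dv {A : Type*} [CommRing A] (a b : A) : A :=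
  open Classical in if h : a ∣ b then h.choose else 0

lemma dv_spec {A : Type*} [CommRing A] {a b : A} (h : a ∣ b) : a * dv a b = b := by
  rw [dv, dif_pos h]; exact h.choose_spec.symm

lemma wedge_self {A : Type*} [CommRing A] [IsDomain A] [CharZero A] (v : Fin ℓ → A)
    (μ : Finset (Fin ℓ) → A) (T : Finset (Fin ℓ)) : wedge1 v (wedge1 v μ) T = 0 :=
  self_eq_neg.1 (wedge1_anti v v μ T)

lemma d_exists (c : Fin n → Fin ℓ → ℂ) (hnz : ∀ i, c i ≠ 0)
    (hprop : ∀ i k, i ≠ k → ∀ t : ℂ, c i ≠ t • c k) (p : ℕ)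
    (μ : Finset (Fin ℓ) → MvPolynomial (Fin n ⊕ Fin ℓ) ℂ) (hμ : μ ∈ OmS c p) :
    ∃ ν ∈ OmS c (p+1), ∀ T, QS c * ν T = wedge1 (Qd c) μ T := by
  rw [mem_OmS c hnz hprop] at hμ
  obtain ⟨h1, h2⟩ := hμ
  choose ν hν using h2
  have hwν : ∀ i k T, fS c i ∣ wedge1 (cS c i) (ν k) T := by
    intro i k T
    have e1 : fS c k * wedge1 (cS c i) (ν k) T = wedge1 (cS c i) (wedge1 (cS c k) μ) T := by
      rw [← wedge1_smul']
      congr 1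
      funext T
      exact (hν k T).symm
    by_cases hik : i = k
    · subst hik
      rw [wedge_self] at e1
      rw [(mul_eq_zero.1 e1).resolve_left (fS_ne c hnz i)]
      exact dvd_zero _
    · refine ((fS_prime c hnz i).dvd_or_dvd (?_ : _ ∣ fS c k * _)).resolve_left
        (fS_ndvd c hprop i k hik)
      rw [e1, wedge1_anti]
      have : wedge1 (cS c i) μ = fun T => fS c i * ν i T := funext (hν i)
      rw [this, wedge1_smul']
      exact (Dvd.intro _ rfl).neg_right
  refine ⟨fun T => ∑ k, X (Sum.inl k) * ν k T, ?_, ?_⟩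
  · rw [mem_OmS c hnz hprop]
    constructor
    · intro T hT
      refine Finset.sum_eq_zero fun k _ => ?_
      have := hν k T
      rw [wedge1_card _ _ p h1 T hT] at this
      rw [(mul_eq_zero.1 this.symm).resolve_left (fS_ne c hnz k), mul_zero]
    · intro i T
      have : wedge1 (cS c i) (fun T => ∑ k, X (Sum.inl k) * ν k T) T =
          ∑ k, X (Sum.inl k) * wedge1 (cS c i) (ν k) T := by
        simp only [wedge1_def, Finset.mul_sum]
        rw [Finset.sum_comm]
        refine Finset.sum_congr rfl fun i _ => Finset.sum_congr rfl fun j _ => by ring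
      rw [this]
      exact Finset.dvd_sum fun k _ => Dvd.dvd.mul_left (hwν i k T) _
  · intro T
    rw [wedge_Qd, Finset.mul_sum]
    refine Finset.sum_congr rfl fun k _ => ?_
    rw [hν k T, QS_eq c k]; ring

variable (c : Fin n → Fin ℓ → ℂ) (hnz : ∀ i, c i ≠ 0)
    (hprop : ∀ i k, i ≠ k → ∀ t : ℂ, c i ≠ t • c k)

/-- The differential: wedge with the universal 1-form. -/
noncomputable def dS (p : ℕ) : OmS c p →ₗ[MvPolynomial (Fin n ⊕ Fin ℓ) ℂ] OmS c (p+1) where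
  toFun μ := ⟨(d_exists c hnz hprop p μ.1 μ.2).choose,
    (d_exists c hnz hprop p μ.1 μ.2).choose_spec.1⟩
  map_add' a b := by
    apply Subtype.ext
    funext T
    apply mul_left_cancel₀ (QS_ne c hnz)
    have h1 := (d_exists c hnz hprop p (a+b).1 (a+b).2).choose_spec.2 T
    have h2 := (d_exists c hnz hprop p a.1 a.2).choose_spec.2 T
    have h3 := (d_exists c hnz hprop p b.1 b.2).choose_spec.2 T
    refine h1.trans ?_
    rw [Submodule.coe_add, wedge1_add, ← h2, ← h3, ← mul_add]
    rfl
  map_smul' r a := by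
    apply Subtype.ext
    funext T
    apply mul_left_cancel₀ (QS_ne c hnz)
    have h1 := (d_exists c hnz hprop p (r • a).1 (r • a).2).choose_spec.2 T
    have h2 := (d_exists c hnz hprop p a.1 a.2).choose_spec.2 T
    refine h1.trans ?_
    rw [Submodule.coe_smul, wedge1_smul, ← h2, mul_left_comm]
    rfl

lemma dS_spec (p : ℕ) (μ : OmS c p) (T : Finset (Fin ℓ)) :
    QS c * (dS c hnz hprop p μ).1 T = wedge1 (Qd c) μ.1 T :=
  (d_exists c hnz hprop p μ.1 μ.2).choose_spec.2 T

lemma dS_dS (p : ℕ) (μ : OmS c p) : dS c hnz hprop (p+1) (dS c hnz hprop p μ) = 0 := by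
  apply Subtype.ext
  funext T
  apply mul_left_cancel₀ (QS_ne c hnz)
  apply mul_left_cancel₀ (QS_ne c hnz)
  rw [dS_spec, ← wedge1_smul']
  have : (fun T => QS c * (dS c hnz hprop p μ).1 T) = wedge1 (Qd c) μ.1 :=
    funext (dS_spec c hnz hprop p μ)
  rw [this, wedge_self]
  simp

lemma pair_Qd (θ : Fin ℓ → MvPolynomial (Fin n ⊕ Fin ℓ) ℂ) :
    ∑ j, θ j * Qd c j = ∑ i, X (Sum.inl i) * Qdiv c i * thf c θ i := by
  simp only [Qd, thf, Finset.mul_sum]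
  rw [Finset.sum_comm]
  refine Finset.sum_congr rfl fun i _ => Finset.sum_congr rfl fun j _ => by ring

lemma ctr_mem (p : ℕ) (θ : Fin ℓ → MvPolynomial (Fin n ⊕ Fin ℓ) ℂ)
    (hnz : ∀ i, c i ≠ 0) (hprop : ∀ i k, i ≠ k → ∀ t : ℂ, c i ≠ t • c k)
    (hθ : ∀ i, fS c i ∣ thf c θ i) (z : Finset (Fin ℓ) → MvPolynomial (Fin n ⊕ Fin ℓ) ℂ)
    (hz : z ∈ OmS c (p+1)) : ctr θ z ∈ OmS c p := by
  rw [mem_OmS c hnz hprop] at hz ⊢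
  refine ⟨ctr_card θ z p hz.1, fun i T => ?_⟩
  rw [eq_sub_of_add_eq' (ctr_wedge θ (cS c i) z T)]
  refine dvd_sub (Dvd.dvd.mul_right (hθ i) _) ?_
  exact Finset.dvd_sum fun j _ => Dvd.dvd.mul_left (hz.2 i _) _

lemma kill_gen (p : ℕ) (y : MvPolynomial (Fin n ⊕ Fin ℓ) ℂ) (hy : y ∈ Ilog c) (z : OmS c p)
    (hz : dS c hnz hprop p z = 0) : y • z ∈ Bd (dS c hnz hprop) p := by
  induction hy using Submodule.span_induction with
  | zero => rw [zero_smul]; exact Submodule.zero_mem _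
  | add a b _ _ ha hb => rw [add_smul]; exact Submodule.add_mem _ ha hb
  | smul r a _ ha => rw [smul_assoc]; exact Submodule.smul_mem _ _ ha
  | mem g hg =>
    obtain ⟨θ, hθ, hp⟩ := hg
    rw [log_iff c hnz hprop] at hθ
    rw [pairs_iff, ← pair_Qd] at hp
    have hw : wedge1 (Qd c) z.1 = 0 := by
      funext T
      rw [← dS_spec c hnz hprop, hz]; simp
    have hom : ∀ T, wedge1 (Qd c) (ctr θ z.1) T = QS c * (g * z.1 T) := by
      intro T
      have h1 := ctr_wedge θ (Qd c) z.1 T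
      rw [hw, show ctr θ (0 : Finset (Fin ℓ) → MvPolynomial (Fin n ⊕ Fin ℓ) ℂ) T = 0 by simp [ctr],
        zero_add, ← hp] at h1
      rw [h1]; ring
    rcases p with _ | p
    · change g • z = 0
      apply Subtype.ext
      funext T
      apply mul_left_cancel₀ (QS_ne c hnz)
      change QS c * (g * z.1 T) = QS c * 0
      rw [← hom, mul_zero]
      have : ctr θ z.1 = 0 := by
        funext T
        refine Finset.sum_eq_zero fun j hj => ?_
        rw [((mem_OmS c hnz hprop 0 z.1).1 z.2).1, mul_zero]
        rw [Finset.card_insert_of_notMem (by simpa using hj)]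
        omega
      rw [this]; simp [wedge1]
    · refine ⟨⟨ctr θ z.1, ctr_mem c p θ hnz hprop hθ z.1 z.2⟩, ?_⟩
      apply Subtype.ext
      funext T
      apply mul_left_cancel₀ (QS_ne c hnz)
      rw [dS_spec, hom]
      rfl

/-- The volume form. -/
noncomputable def vol : OmS c ℓ :=
  ⟨fun T => if T = univ then 1 else 0, by
    constructor
    · intro T hT
      change (if T = univ then 1 else 0) = _
      rw [if_neg]
      rintro rfl
      simp at hT
    · intro T
      rw [wedge1_card _ _ ℓ]
      · exact dvd_zero _
      · intro T hT
        rw [if_neg]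
        rintro rfl
        simp at hT
      · have := Finset.card_le_univ T
        rw [Fintype.card_fin] at this
        omega⟩

lemma eq_vol (z : OmS c ℓ) : z = z.1 univ • vol c := by
  apply Subtype.ext
  funext T
  change z.1 T = z.1 univ * (if T = univ then 1 else 0)
  split_ifs with h
  · rw [h, mul_one]
  · rw [mul_zero]
    apply z.2.1
    intro h2
    exact h ((Finset.card_eq_iff_eq_univ T).1 (by simpa using h2))

lemma d_top (z : OmS c ℓ) : dS c hnz hprop ℓ z = 0 := by
  apply Subtype.ext
  funext T
  apply (dS c hnz hprop ℓ z).2.1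
  have := Finset.card_le_univ T
  rw [Fintype.card_fin] at this
  omega

lemma univ_mem (p : ℕ) (hp : p = ℓ) (z : OmS c p) (hz : z ∈ Bd (dS c hnz hprop) p) : z.1 univ ∈ Ilog c := by
  rcases p with _ | p
  · rw [show z = 0 from hz]; exact Submodule.zero_mem _
  · obtain ⟨ν, rfl⟩ := hz
    apply Ideal.subset_span
    have hν := (mem_OmS c hnz hprop p ν.1).1 ν.2
    refine ⟨fun j => sg _ univ j * ν.1 (univ.erase j), ?_, ?_⟩
    · rw [log_iff c hnz hprop]
      intro i
      convert hν.2 i univ using 1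
      rw [wedge1_def, thf]
      refine Finset.sum_congr rfl fun j _ => ?_
      rw [cS]; ring
    · rw [pairs_iff, dS_spec, ← pair_Qd, wedge1_def]
      refine Finset.sum_congr rfl fun j _ => by ring

/-- cokernel of the complex. -/
noncomputable def cokS : (OmS c ℓ ⧸ Bd (dS c hnz hprop) ℓ) ≃ₗ[MvPolynomial (Fin n ⊕ Fin ℓ) ℂ]
    (MvPolynomial (Fin n ⊕ Fin ℓ) ℂ ⧸ Ilog c) :=
  let π : OmS c ℓ →ₗ[MvPolynomial (Fin n ⊕ Fin ℓ) ℂ] (MvPolynomial (Fin n ⊕ Fin ℓ) ℂ ⧸ Ilog c) :=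
    (Submodule.mkQ (Ilog c)) ∘ₗ (LinearMap.proj univ) ∘ₗ (OmS c ℓ).subtype
  have hk : Bd (dS c hnz hprop) ℓ = LinearMap.ker π := by
    apply le_antisymm
    · intro z hz
      rw [LinearMap.mem_ker]
      exact (Submodule.Quotient.mk_eq_zero _).2 (univ_mem c hnz hprop ℓ rfl z hz)
    · intro z hz
      have hz' : z.1 univ ∈ Ilog c := (Submodule.Quotient.mk_eq_zero _).1 hz
      rw [eq_vol c z]
      exact kill_gen c hnz hprop ℓ _ hz' _ (d_top c hnz hprop _)
  (Submodule.quotEquivOfEq _ _ hk).trans (π.quotKerEquivOfSurjective (by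
    intro x
    obtain ⟨x, rfl⟩ := Submodule.Quotient.mk_surjective _ x
    refine ⟨x • vol c, ?_⟩
    change Submodule.Quotient.mk (x * (if univ = univ then 1 else 0)) = _
    rw [if_pos rfl, mul_one]))

include hnz in
lemma one_nmem : (1 : MvPolynomial (Fin n ⊕ Fin ℓ) ℂ) ∉ Ilog c := by
  let φ : MvPolynomial (Fin n ⊕ Fin ℓ) ℂ →ₐ[ℂ] MvPolynomial (Fin n ⊕ Fin ℓ) ℂ :=
    aeval (Sum.elim (fun _ => 0) (fun j => X (Sum.inr j)))
  have hf : ∀ i, φ (fS c i) = fS c i := by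
    intro i
    simp [φ, fS, algebraMap_eq]
  have hle : Ilog c ≤ RingHom.ker φ := by
    rw [Ilog, Ideal.span_le]
    rintro g ⟨θ, -, hp⟩
    have h2 := congrArg φ ((pairs_iff c θ g).1 hp)
    rw [map_mul, map_sum, Finset.sum_eq_zero, QS, map_prod] at h2
    · simp only [hf] at h2
      exact (mul_eq_zero.1 h2).resolve_left (QS_ne c hnz)
    · intro i _
      simp [φ]
  intro h
  have := hle h
  rw [RingHom.mem_ker, map_one] at this
  exact one_ne_zero this

end LogS

section BaseCh
open TensorProduct CategoryTheory CategoryTheory.Abelian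

lemma bc_HP {R S : Type} [CommRing R] [CommRing S] [Algebra R S] [Module.Flat R S] (m : ℕ) :
    ∀ (M : Type) [AddCommGroup M] [Module R M], pdLE R m M → HP S (m+1) (S ⊗[R] M) := by
  induction m with
  | zero =>
    intro M _ _ h
    have h' : Module.Projective R M := h
    exact projective_iff_hasProjectiveDimensionLT_one.1
      ((IsProjective.iff_projective (S ⊗[R] M)).1 inferInstance)
  | succ m ih =>
    rintro M _ _ ⟨k, φ, hs, hk⟩
    have hex := LinearMap.exact_subtype_ker_map φ
    have hse := scx_se ((LinearMap.ker φ).subtype.baseChange S) (φ.baseChange S)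
      (Module.Flat.lTensor_exact S hex)
      (Module.Flat.lTensor_preserves_injective_linearMap _ (Submodule.subtype_injective _))
      (LinearMap.lTensor_surjective S hs)
    exact (hse.hasProjectiveDimensionLT_X₃_iff m
      ((IsProjective.iff_projective (S ⊗[R] (Fin k → R))).1 inferInstance)).2 (ih _ hk)

lemma wedge1_map {ℓ : ℕ} {R S : Type} [CommRing R] [CommRing S] [Algebra R S] (v : Fin ℓ → R)
    (μ : Finset (Fin ℓ) → R) (T : Finset (Fin ℓ)) :
    wedge1 (fun j => algebraMap R S (v j)) (fun T => algebraMap R S (μ T)) T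
      = algebraMap R S (wedge1 v μ T) := by
  simp [wedge1, map_sum]

lemma wedge1_lin {ℓ : ℕ} {R S : Type} [CommRing R] [CommRing S] [Algebra R S] (v : Fin ℓ → R)
    (f : S →ₗ[R] R) (μ : Finset (Fin ℓ) → S) (T : Finset (Fin ℓ)) :
    f (wedge1 (fun j => algebraMap R S (v j)) μ T) = wedge1 v (fun T => f (μ T)) T := by
  simp only [wedge1, map_sum]
  refine Finset.sum_congr rfl fun j _ => ?_
  rw [← smul_eq_mul (_ * v j), ← map_smul f]
  congr 1
  rw [Algebra.smul_def]
  simp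

lemma bc_equiv {ℓ : ℕ} {R S κ : Type} [CommRing R] [CommRing S] [Algebra R S]
    (b : Module.Basis κ R S) (Q : R) (v : Fin ℓ → R) (p : ℕ)
    (LR : Submodule R (Finset (Fin ℓ) → R)) (LS : Submodule S (Finset (Fin ℓ) → S))
    (hR : ∀ μ, μ ∈ LR ↔ (∀ T, T.card ≠ p → μ T = 0) ∧ ∀ T, Q ∣ wedge1 v μ T)
    (hS : ∀ μ, μ ∈ LS ↔ (∀ T, T.card ≠ p → μ T = 0) ∧
      ∀ T, algebraMap R S Q ∣ wedge1 (fun j => algebraMap R S (v j)) μ T) :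
    Nonempty ((S ⊗[R] LR) ≃ₗ[S] LS) := by
  classical
  have hfree : Module.Free R S := Module.Free.of_basis b
  let Ψ : (S ⊗[R] LR) →ₗ[S] (Finset (Fin ℓ) → S) :=
    (TensorProduct.piScalarRight R S S (Finset (Fin ℓ))).toLinearMap ∘ₗ (LR.subtype.baseChange S)
  have hΨ : ∀ s (μ : LR) T, Ψ (s ⊗ₜ μ) T = s * algebraMap R S (μ.1 T) := by
    intro s μ T
    simp [Ψ, Algebra.smul_def, mul_comm]
  have hinj : Function.Injective Ψ :=
    (TensorProduct.piScalarRight R S S (Finset (Fin ℓ))).injective.comp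
      (Module.Flat.lTensor_preserves_injective_linearMap _ (Submodule.subtype_injective _))
  have hrange : LinearMap.range Ψ = LS := by
    apply le_antisymm
    · rintro _ ⟨x, rfl⟩
      induction x using TensorProduct.induction_on with
      | zero => rw [map_zero]; exact LS.zero_mem
      | add a b ha hb => rw [map_add]; exact LS.add_mem ha hb
      | tmul s μ =>
        have : Ψ (s ⊗ₜ μ) = s • (fun T => algebraMap R S (μ.1 T)) := by
          funext T; rw [hΨ]; rfl
        rw [this]
        apply LS.smul_mem
        rw [hS]
        obtain ⟨h1, h2⟩ := (hR μ.1).1 μ.2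
        refine ⟨fun T hT => by rw [h1 T hT, map_zero], fun T => ?_⟩
        rw [wedge1_map]
        exact map_dvd _ (h2 T)
    · intro μ hμ
      obtain ⟨h1, h2⟩ := (hS μ).1 hμ
      have hk : ∀ k, (fun T => b.coord k (μ T)) ∈ LR := by
        intro k
        rw [hR]
        refine ⟨fun T hT => by rw [h1 T hT, map_zero], fun T => ?_⟩
        rw [← wedge1_lin]
        obtain ⟨g, hg⟩ := h2 T
        rw [hg, ← Algebra.smul_def, map_smul]
        exact Dvd.intro _ rfl
      let K : Finset κ := Finset.univ.biUnion fun T => (b.repr (μ T)).support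
      refine ⟨∑ k ∈ K, b k ⊗ₜ ⟨_, hk k⟩, ?_⟩
      funext T
      rw [map_sum, Finset.sum_apply]
      simp only [hΨ]
      conv_rhs => rw [← b.linearCombination_repr (μ T)]
      rw [Finsupp.linearCombination_apply, Finsupp.sum_of_support_subset (s := K)]
      · refine Finset.sum_congr rfl fun k _ => ?_
        rw [Algebra.smul_def, mul_comm]; rfl
      · exact Finset.subset_biUnion_of_mem (fun T => (b.repr (μ T)).support) (Finset.mem_univ T)
      · intro i _; rw [zero_smul]
  exact ⟨(LinearEquiv.ofInjective Ψ hinj).trans (LinearEquiv.ofEq _ _ hrange)⟩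

lemma pd_OmS {ℓ n : ℕ} (c : Fin n → Fin ℓ → ℂ) (p : ℕ)
    (h : pdLE (MvPolynomial (Fin ℓ) ℂ) p (logForms ℓ (Qx c) p)) :
    HP (MvPolynomial (Fin n ⊕ Fin ℓ) ℂ) (p+1) (OmS c p) := by
  let ρ : MvPolynomial (Fin ℓ) ℂ →ₐ[ℂ] MvPolynomial (Fin n ⊕ Fin ℓ) ℂ := rename Sum.inr
  let _ : Algebra (MvPolynomial (Fin ℓ) ℂ) (MvPolynomial (Fin n ⊕ Fin ℓ) ℂ) := ρ.toRingHom.toAlgebra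
  have hal : ∀ r, algebraMap (MvPolynomial (Fin ℓ) ℂ) (MvPolynomial (Fin n ⊕ Fin ℓ) ℂ) r
    = rename Sum.inr r := fun _ => rfl
  let e := sumAlgEquiv ℂ (Fin n) (Fin ℓ)
  have he : ∀ r, e (rename Sum.inr r) = C r := by
    intro r
    have : (e.toAlgHom.comp ρ) = Algebra.algHom ℂ (MvPolynomial (Fin ℓ) ℂ)
        (MvPolynomial (Fin n) (MvPolynomial (Fin ℓ) ℂ)) := by
      ext j : 1
      change sumAlgEquiv ℂ (Fin n) (Fin ℓ) (rename Sum.inr (X j)) = C (X j)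
      rw [rename_X]
      simp
    exact congrArg (fun f => f r) this
  let E : MvPolynomial (Fin n ⊕ Fin ℓ) ℂ ≃ₗ[MvPolynomial (Fin ℓ) ℂ]
      MvPolynomial (Fin n) (MvPolynomial (Fin ℓ) ℂ) :=
    { e.toRingEquiv.toAddEquiv with
      map_smul' := by
        intro r s
        change e (r • s) = r • e s
        rw [Algebra.smul_def, hal, map_mul, he, ← smul_eq_C_mul] }
  let b := (basisMonomials (Fin n) (MvPolynomial (Fin ℓ) ℂ)).map E.symm
  have hQ : rename Sum.inr (Qx c) = QS c := by
    simp [Qx, QS, fS]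
  have hfree : Module.Free (MvPolynomial (Fin ℓ) ℂ) (MvPolynomial (Fin n ⊕ Fin ℓ) ℂ) :=
    Module.Free.of_basis b
  obtain ⟨F⟩ := bc_equiv b (Qx c) (fun j => pderiv j (Qx c)) p (logForms ℓ (Qx c) p) (OmS c p)
    (fun μ => Iff.rfl) (by
      intro μ
      have : ∀ j, algebraMap (MvPolynomial (Fin ℓ) ℂ) (MvPolynomial (Fin n ⊕ Fin ℓ) ℂ)
          (pderiv j (Qx c)) = pderiv (Sum.inr j) (QS c) := by
        intro j
        rw [hal, ← hQ, pderiv_rename Sum.inr_injective]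
      simp only [this]
      rw [hal, hQ]
      exact Iff.rfl)
  exact HP_equiv F (bc_HP p _ h)

end BaseCh

theorem tame_implies_critical_ring_cohen_macaulay
    (ℓ n : ℕ) (c : Fin n → Fin ℓ → ℂ)
    (hnz : ∀ i, c i ≠ 0)
    (hprop : ∀ i k, i ≠ k → ∀ t : ℂ, c i ≠ t • c k)
    (hess : Submodule.span ℂ (Set.range c) = ⊤)
    (htame : ArrTame c) :
    ∀ m : ℕ, pdLE (MvPolynomial (Fin n ⊕ Fin ℓ) ℂ) m
        (MvPolynomial (Fin n ⊕ Fin ℓ) ℂ ⧸ Ilog c) ↔ ℓ ≤ m := by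
  intro m
  constructor
  · intro h
    by_contra hm
    have h0 := EX_pd (N := MvPolynomial (Fin n ⊕ Fin ℓ) ℂ ⧸ Ilog c) ℓ (grade_I c hess) m
      (MvPolynomial (Fin n ⊕ Fin ℓ) ℂ ⧸ Ilog c) h 0 (by omega)
    have h1 := congrArg (fun f => f (Submodule.Quotient.mk 1)) (EX0_hom h0 LinearMap.id)
    exact one_nmem c hnz ((Submodule.Quotient.mk_eq_zero _).1 h1)
  · intro hm
    apply HP_pdLE
    have hpd : ∀ p ≤ ℓ, HP (MvPolynomial (Fin n ⊕ Fin ℓ) ℂ) (p+1) (OmS c p) :=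
      fun p hp => pd_OmS c p (htame p hp)
    have h := acyc_final (Ilog c) (Ω := fun p => OmS c p) (dS c hnz hprop) (dS_dS c hnz hprop) ℓ
      (fun p _ => kill_gen c hnz hprop p)
      (fun p hp j hj => EX_pd ℓ (grade_I c hess) p _ (HP_pdLE p _ (hpd p hp.le)) j hj) hpd
    have h2 := HP_equiv (cokS c hnz hprop) h
    exact CategoryTheory.hasProjectiveDimensionLT_of_ge _ (ℓ+1) (m+1) (by omega)
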